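/- arXiv:1207.6464 — 5 statements merged into one kernel-verified Lean document; each statement's English description precedes it below -/
import Mathlib

section
/- Let n ≥ 1 be an integer, b > 0 and d ∈ ℝ, with b not a positive integer and d not a nonnegative integer. If (d,b) lies below the staircase E_n, i.e. there exists k ∈ {0,…,n−1} with d < k and b < n−k, then the kernel T_{b,d} is not sign regular of order n+1: for every choice of signs ε₁,…,ε_{n+1} ∈ {−1,1}, there exist m ∈ {1,…,n+1} and reals 0 < x₁ < … < x_m, 0 < y₁ < … < y_m with ε_m·det[T_{b,d}(x_i, y_j)]_{1≤i,j≤m} < 0. -/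
/-- `f b ν z = Ψ(b, b+1-ν, z)`, the Tricomi confluent hypergeometric function,
given by its integral representation. -/
noncomputable def tricomiF (b ν z : ℝ) : ℝ :=
  (1 / Real.Gamma b) * ∫ t in Set.Ioi (0:ℝ), Real.exp (-t * z) * t ^ (b - 1) * (1 + t) ^ (-ν)

/-- The kernel `T_{b,d}(x,y) = e^{-x/y} Ψ(b, b+1-d, x/y)`. -/
noncomputable def kernelT (b d x y : ℝ) : ℝ :=
  Real.exp (-(x / y)) * tricomiF b d (x / y)

open Set Filter Topology MeasureTheory

/-! ### The Laplace integral defining the Tricomi function -/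

/-- The integrand of the Laplace integral defining the Tricomi function. -/
noncomputable def tricomiIntegrand (b ν z t : ℝ) : ℝ :=
  Real.exp (-t * z) * t ^ (b - 1) * (1 + t) ^ (-ν)

theorem tricomiIntegrand_pos (b ν z : ℝ) {t : ℝ} (ht : 0 < t) : 0 < tricomiIntegrand b ν z t := by
  unfold tricomiIntegrand
  positivity

theorem continuousOn_tricomiIntegrand (b ν z : ℝ) :
    ContinuousOn (tricomiIntegrand b ν z) (Ioi 0) := by
  intro t ht
  have ht : 0 < t := ht
  unfold tricomiIntegrand
  apply ContinuousAt.continuousWithinAt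
  have h1 : ContinuousAt (fun t : ℝ => t ^ (b - 1)) t :=
    Real.continuousAt_rpow_const _ _ (Or.inl ht.ne')
  have h2 : ContinuousAt (fun t : ℝ => (1 + t) ^ (-ν)) t :=
    ContinuousAt.rpow_const (by fun_prop) (Or.inl (by positivity))
  fun_prop

theorem aestronglyMeasurable_tricomiIntegrand (b ν z : ℝ) :
    AEStronglyMeasurable (tricomiIntegrand b ν z) (volume.restrict (Ioi 0)) :=
  (continuousOn_tricomiIntegrand b ν z).aestronglyMeasurable measurableSet_Ioi

theorem tricomiIntegrand_sub_one (b ν z : ℝ) {t : ℝ} (ht : 0 < t) :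
    tricomiIntegrand b (ν - 1) z t = (1 + t) * tricomiIntegrand b ν z t := by
  unfold tricomiIntegrand
  rw [show -(ν - 1) = -ν + 1 by ring, Real.rpow_add_one (by positivity)]
  ring

theorem tricomiIntegrand_add_one_left (b ν z : ℝ) {t : ℝ} (ht : 0 < t) :
    tricomiIntegrand (b + 1) ν z t = t * tricomiIntegrand b ν z t := by
  unfold tricomiIntegrand
  rw [show b + 1 - 1 = (b - 1) + 1 by ring, Real.rpow_add_one (by positivity)]
  ring

theorem tricomiIntegrand_anti (b ν : ℝ) {z z' t : ℝ} (ht : 0 < t) (hz : z ≤ z') :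
    tricomiIntegrand b ν z' t ≤ tricomiIntegrand b ν z t := by
  unfold tricomiIntegrand
  have : Real.exp (-t * z') ≤ Real.exp (-t * z) := Real.exp_le_exp.2 (by nlinarith)
  gcongr

theorem one_add_rpow_le_mul_exp (ν : ℝ) {c : ℝ} (hc : 0 < c) :
    ∃ K : ℝ, ∀ t : ℝ, 0 < t → (1 + t) ^ (-ν) ≤ K * Real.exp (c * t) := by
  obtain ⟨N, hN⟩ := exists_nat_ge (-ν)
  refine ⟨N.factorial / c ^ N * Real.exp c, fun t ht => ?_⟩
  have h1 : (1 + t) ^ (-ν) ≤ (1 + t) ^ N := by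
    rw [← Real.rpow_natCast]
    exact Real.rpow_le_rpow_of_exponent_le (by linarith) hN
  have h2 := Real.pow_div_factorial_le_exp (c * (1 + t)) (by positivity) N
  rw [div_le_iff₀ (by positivity), mul_pow] at h2
  calc (1 + t) ^ (-ν) ≤ (1 + t) ^ N := h1
    _ = (c ^ N * (1 + t) ^ N) / c ^ N := by field_simp
    _ ≤ Real.exp (c * (1 + t)) * N.factorial / c ^ N := by gcongr
    _ = N.factorial / c ^ N * Real.exp c * Real.exp (c * t) := by
      rw [show c * (1 + t) = c + c * t by ring, Real.exp_add]
      ring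

theorem integrableOn_tricomiIntegrand {b z : ℝ} (ν : ℝ) (hb : 0 < b) (hz : 0 < z) :
    IntegrableOn (tricomiIntegrand b ν z) (Ioi 0) := by
  obtain ⟨K, hK⟩ := one_add_rpow_le_mul_exp ν (half_pos hz)
  have h := (integrableOn_rpow_mul_exp_neg_mul_rpow (p := 1) (s := b - 1) (b := z / 2)
    (by linarith) one_pos (half_pos hz)).const_mul K
  refine Integrable.mono' h (aestronglyMeasurable_tricomiIntegrand b ν z) ?_
  filter_upwards [ae_restrict_mem measurableSet_Ioi] with t ht
  have ht : 0 < t := ht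
  rw [Real.norm_of_nonneg (tricomiIntegrand_pos b ν z ht).le, Real.rpow_one]
  unfold tricomiIntegrand
  calc Real.exp (-t * z) * t ^ (b - 1) * (1 + t) ^ (-ν)
      ≤ Real.exp (-t * z) * t ^ (b - 1) * (K * Real.exp (z / 2 * t)) := by
        gcongr
        exact hK t ht
    _ = K * (t ^ (b - 1) * Real.exp (-(z / 2) * t)) := by
        rw [show -(z / 2) * t = -t * z + z / 2 * t by ring, Real.exp_add]
        ring

theorem integrableOn_tricomiIntegrand_zero {b ν : ℝ} (hb : 0 < b) (hν : b < ν) :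
    IntegrableOn (tricomiIntegrand b ν 0) (Ioi 0) := by
  rw [← Ioc_union_Ioi_eq_Ioi (zero_le_one' ℝ)]
  refine IntegrableOn.union ?_ ?_
  · have h : IntegrableOn (fun t : ℝ => t ^ (b - 1)) (Ioc 0 1) :=
      (intervalIntegrable_iff_integrableOn_Ioc_of_le zero_le_one).1
        (intervalIntegral.intervalIntegrable_rpow' (by linarith))
    refine Integrable.mono' h ((continuousOn_tricomiIntegrand b ν 0).mono
      Ioc_subset_Ioi_self |>.aestronglyMeasurable measurableSet_Ioc) ?_
    filter_upwards [ae_restrict_mem measurableSet_Ioc] with t ht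
    rw [Real.norm_of_nonneg (tricomiIntegrand_pos b ν 0 ht.1).le]
    unfold tricomiIntegrand
    have h1 : (1 + t) ^ (-ν) ≤ 1 :=
      Real.rpow_le_one_of_one_le_of_nonpos (by linarith [ht.1]) (by linarith)
    have h2 : 0 ≤ t ^ (b - 1) := Real.rpow_nonneg ht.1.le _
    simpa using mul_le_mul_of_nonneg_left h1 h2
  · have h : IntegrableOn (fun t : ℝ => t ^ (b - 1 - ν)) (Ioi 1) :=
      integrableOn_Ioi_rpow_of_lt (by linarith) one_pos
    refine Integrable.mono' h ((continuousOn_tricomiIntegrand b ν 0).mono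
      (Ioi_subset_Ioi zero_le_one) |>.aestronglyMeasurable measurableSet_Ioi) ?_
    filter_upwards [ae_restrict_mem measurableSet_Ioi] with t ht
    have ht0 : 0 < t := lt_trans one_pos ht
    rw [Real.norm_of_nonneg (tricomiIntegrand_pos b ν 0 ht0).le]
    unfold tricomiIntegrand
    have h1 : (1 + t) ^ (-ν) ≤ t ^ (-ν) :=
      Real.rpow_le_rpow_of_nonpos ht0 (by linarith) (by linarith)
    rw [sub_eq_add_neg (b - 1), Real.rpow_add ht0]
    have h2 : 0 ≤ t ^ (b - 1) := Real.rpow_nonneg ht0.le _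
    simpa using mul_le_mul_of_nonneg_left h1 h2

/-- The Laplace integral defining the Tricomi function, without the Gamma factor. -/
noncomputable def tricomiInt (b ν z : ℝ) : ℝ :=
  ∫ t in Ioi (0:ℝ), tricomiIntegrand b ν z t

theorem tricomiF_eq (b ν z : ℝ) : tricomiF b ν z = (1 / Real.Gamma b) * tricomiInt b ν z := rfl

theorem tricomiInt_pos {b z : ℝ} (ν : ℝ) (hb : 0 < b) (hz : 0 < z) : 0 < tricomiInt b ν z := by
  unfold tricomiInt
  rw [setIntegral_pos_iff_support_of_nonneg_ae _ (integrableOn_tricomiIntegrand ν hb hz)]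
  · refine lt_of_lt_of_le (b := volume (Ioi (0:ℝ))) (by simp) (measure_mono fun t ht => ?_)
    exact ⟨(tricomiIntegrand_pos b ν z ht).ne', ht⟩
  · filter_upwards [ae_restrict_mem measurableSet_Ioi] with t ht
    exact (tricomiIntegrand_pos b ν z ht).le

theorem tricomiInt_anti {b z z' : ℝ} (ν : ℝ) (hb : 0 < b) (hz : 0 < z) (h : z ≤ z') :
    tricomiInt b ν z' ≤ tricomiInt b ν z :=
  setIntegral_mono_on (integrableOn_tricomiIntegrand ν hb (hz.trans_le h))
    (integrableOn_tricomiIntegrand ν hb hz) measurableSet_Ioi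
    fun _ ht => tricomiIntegrand_anti b ν ht h

theorem tricomiInt_le_zero {b ν z : ℝ} (hb : 0 < b) (hν : b < ν) (hz : 0 < z) :
    tricomiInt b ν z ≤ tricomiInt b ν 0 :=
  setIntegral_mono_on (integrableOn_tricomiIntegrand ν hb hz)
    (integrableOn_tricomiIntegrand_zero hb hν) measurableSet_Ioi
    fun _ ht => tricomiIntegrand_anti b ν ht hz.le

theorem tricomiInt_add_one_left {b z : ℝ} (ν : ℝ) (hb : 0 < b) (hz : 0 < z) :
    tricomiInt (b + 1) ν z = tricomiInt b (ν - 1) z - tricomiInt b ν z := by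
  unfold tricomiInt
  rw [← integral_sub (integrableOn_tricomiIntegrand _ hb hz)
    (integrableOn_tricomiIntegrand _ hb hz)]
  refine setIntegral_congr_fun measurableSet_Ioi fun t ht => ?_
  simp only [tricomiIntegrand_add_one_left b ν z ht, tricomiIntegrand_sub_one b ν z ht]
  ring

theorem hasDerivAt_tricomiInt {b z : ℝ} (ν : ℝ) (hb : 0 < b) (hz : 0 < z) :
    HasDerivAt (tricomiInt b ν) (-tricomiInt (b + 1) ν z) z := by
  have h := hasDerivAt_integral_of_dominated_loc_of_deriv_le
    (μ := volume.restrict (Ioi (0:ℝ))) (F := tricomiIntegrand b ν)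
    (F' := fun z t => -tricomiIntegrand (b + 1) ν z t) (x₀ := z) (s := Ioi (z / 2))
    (bound := tricomiIntegrand (b + 1) ν (z / 2))
    (Ioi_mem_nhds (by linarith))
    (Eventually.of_forall fun z' => aestronglyMeasurable_tricomiIntegrand b ν z')
    (integrableOn_tricomiIntegrand ν hb hz)
    (aestronglyMeasurable_tricomiIntegrand _ ν z).neg ?_
    (integrableOn_tricomiIntegrand ν (by linarith) (half_pos hz)) ?_
  · rw [integral_neg] at h
    exact h.2
  · filter_upwards [ae_restrict_mem measurableSet_Ioi] with t ht z' hz'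
    rw [norm_neg, Real.norm_of_nonneg (tricomiIntegrand_pos _ ν _ ht).le]
    exact tricomiIntegrand_anti _ _ ht (le_of_lt hz')
  · filter_upwards [ae_restrict_mem measurableSet_Ioi] with t ht z' _
    rw [tricomiIntegrand_add_one_left b ν z' ht]
    have h1 : HasDerivAt (fun z : ℝ => Real.exp (-t * z)) (Real.exp (-t * z') * (-t)) z' := by
      simpa using ((hasDerivAt_id z').const_mul (-t)).exp
    have h2 := (h1.mul_const (t ^ (b - 1))).mul_const ((1 + t) ^ (-ν))
    refine h2.congr_deriv ?_
    unfold tricomiIntegrand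
    ring

theorem tendsto_exp_neg_mul_one_add_rpow (ν : ℝ) {z : ℝ} (hz : 0 < z) :
    Tendsto (fun t : ℝ => Real.exp (-t * z) * (1 + t) ^ ν) atTop (𝓝 0) := by
  have h := (tendsto_rpow_mul_exp_neg_mul_atTop_nhds_zero ν z hz).comp
    (tendsto_atTop_add_const_left atTop (1:ℝ) tendsto_id)
  have h2 := h.const_mul (Real.exp z)
  rw [mul_zero] at h2
  refine h2.congr fun t => ?_
  simp only [Function.comp, id]
  rw [show -z * (1 + t) = -z + -t * z by ring, Real.exp_add, Real.exp_neg]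
  field_simp

/-- Integration by parts in the Laplace integral. -/
theorem mul_tricomiInt {b z : ℝ} (ν : ℝ) (hb : 0 < b) (hz : 0 < z) :
    b * tricomiInt b ν z =
      z * tricomiInt (b + 1) ν z + ν * tricomiInt (b + 1) (ν + 1) z := by
  have hi1 := (integrableOn_tricomiIntegrand ν hb hz).const_mul b
  have hi2 := (integrableOn_tricomiIntegrand ν (b := b + 1) (by linarith) hz).const_mul z
  have hi3 := (integrableOn_tricomiIntegrand (ν + 1) (b := b + 1) (by linarith) hz).const_mul ν
  have key := integral_Ioi_of_hasDerivAt_of_tendsto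
    (f := fun t : ℝ => Real.exp (-t * z) * t ^ b * (1 + t) ^ (-ν))
    (f' := fun t : ℝ => b * tricomiIntegrand b ν z t - z * tricomiIntegrand (b + 1) ν z t
      - ν * tricomiIntegrand (b + 1) (ν + 1) z t) (a := 0) (m := 0) ?_ ?_
      ((hi1.sub hi2).sub hi3) ?_
  · have h := integral_sub (hi1.sub hi2) hi3
    simp only [Pi.sub_apply] at h
    rw [h, integral_sub hi1 hi2, integral_const_mul, integral_const_mul,
      integral_const_mul] at key
    simp only [Real.zero_rpow hb.ne', mul_zero, zero_mul, sub_zero] at key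
    unfold tricomiInt
    linarith
  · apply ContinuousAt.continuousWithinAt
    have h1 : ContinuousAt (fun t : ℝ => t ^ b) 0 :=
      Real.continuousAt_rpow_const _ _ (Or.inr hb.le)
    have h2 : ContinuousAt (fun t : ℝ => (1 + t) ^ (-ν)) 0 :=
      ContinuousAt.rpow_const (by fun_prop) (Or.inl (by norm_num))
    fun_prop
  · intro t ht
    have ht : 0 < t := ht
    have h1 : HasDerivAt (fun t : ℝ => Real.exp (-t * z)) (Real.exp (-t * z) * (-z)) t := by
      simpa using ((hasDerivAt_id t).neg.mul_const z).exp
    have h2 : HasDerivAt (fun t : ℝ => t ^ b) (b * t ^ (b - 1)) t :=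
      Real.hasDerivAt_rpow_const (Or.inl ht.ne')
    have h3 : HasDerivAt (fun t : ℝ => (1 + t) ^ (-ν)) (-ν * (1 + t) ^ (-ν - 1)) t := by
      have := ((hasDerivAt_id t).const_add 1).rpow_const (p := -ν) (Or.inl (by simp; positivity))
      simpa using this
    refine ((h1.mul h2).mul h3).congr_deriv ?_
    simp only [tricomiIntegrand, Pi.mul_apply]
    rw [show b + 1 - 1 = b by ring, show -(ν + 1) = -ν - 1 by ring]
    ring
  · have h := tendsto_exp_neg_mul_one_add_rpow (b - ν) hz
    refine squeeze_zero' ?_ ?_ h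
    · filter_upwards [eventually_gt_atTop 0] with t ht
      positivity
    · filter_upwards [eventually_gt_atTop 0] with t ht
      rw [sub_eq_add_neg, Real.rpow_add (by positivity), ← mul_assoc]
      gcongr
      linarith

theorem tricomiInt_add_one_lt {b z : ℝ} (ν : ℝ) (hb : 0 < b) (hz : 0 < z) :
    tricomiInt b (ν + 1) z < tricomiInt b ν z := by
  have h := tricomiInt_add_one_left (ν + 1) hb hz
  rw [add_sub_cancel_right] at h
  linarith [tricomiInt_pos (ν + 1) (show 0 < b + 1 by linarith) hz]

/-! ### Behaviour of the Laplace integral near zero -/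

theorem tendsto_tricomiInt_atTop {b ν : ℝ} (hb : 0 < b) (hν : ν ≤ b) :
    Tendsto (tricomiInt b ν) (𝓝[>] 0) atTop := by
  obtain ⟨c, hc, hle⟩ : ∃ c : ℝ, 0 < c ∧
      ∀ t : ℝ, 1 ≤ t → c * t⁻¹ ≤ t ^ (b - 1) * (1 + t) ^ (-ν) := by
    have hpow : ∃ c : ℝ, 0 < c ∧ ∀ t : ℝ, 1 ≤ t → c * t ^ (-ν) ≤ (1 + t) ^ (-ν) := by
      rcases le_total ν 0 with h | h
      · refine ⟨1, one_pos, fun t ht => ?_⟩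
        rw [one_mul]
        exact Real.rpow_le_rpow (by linarith) (by linarith) (by linarith)
      · refine ⟨2 ^ (-ν), by positivity, fun t ht => ?_⟩
        rw [← Real.mul_rpow zero_le_two (by linarith)]
        exact Real.rpow_le_rpow_of_nonpos (by linarith) (by linarith) (by linarith)
    obtain ⟨c, hc, h⟩ := hpow
    refine ⟨c, hc, fun t ht => ?_⟩
    have ht0 : 0 < t := by linarith
    have h1 : t⁻¹ ≤ t ^ (b - 1) * t ^ (-ν) := by
      rw [← Real.rpow_add ht0, ← Real.rpow_neg_one]
      exact Real.rpow_le_rpow_of_exponent_le ht (by linarith)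
    calc c * t⁻¹ ≤ c * (t ^ (b - 1) * t ^ (-ν)) := by gcongr
      _ = t ^ (b - 1) * (c * t ^ (-ν)) := by ring
      _ ≤ _ := mul_le_mul_of_nonneg_left (h t ht) (by positivity)
  have hlog : Tendsto (fun z : ℝ => Real.exp (-1) * c * Real.log z⁻¹) (𝓝[>] 0) atTop :=
    (Real.tendsto_log_atTop.comp tendsto_inv_nhdsGT_zero).const_mul_atTop (by positivity)
  refine tendsto_atTop_mono' _ ?_ hlog
  filter_upwards [Ioo_mem_nhdsGT (zero_lt_one' ℝ)] with z hz
  have hz1 : 1 ≤ z⁻¹ := (one_le_inv₀ hz.1).2 hz.2.le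
  have hint := integrableOn_tricomiIntegrand ν hb hz.1
  have hsub : Ioc 1 z⁻¹ ⊆ Ioi (0:ℝ) := fun t ht => lt_trans one_pos ht.1
  calc Real.exp (-1) * c * Real.log z⁻¹
      = ∫ t in Ioc 1 z⁻¹, Real.exp (-1) * c * t⁻¹ := by
        rw [← intervalIntegral.integral_of_le hz1, intervalIntegral.integral_const_mul,
          integral_inv_of_pos one_pos (by linarith), div_one]
    _ ≤ ∫ t in Ioc 1 z⁻¹, tricomiIntegrand b ν z t := by
        refine setIntegral_mono_on ?_ (hint.mono_set hsub) measurableSet_Ioc fun t ht => ?_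
        · refine (ContinuousOn.integrableOn_Icc ?_).mono_set Ioc_subset_Icc_self
          exact continuousOn_const.mul
            (continuousOn_id.inv₀ fun t ht => (lt_of_lt_of_le one_pos ht.1).ne')
        · have h1 : t * z ≤ 1 := by
            calc t * z ≤ z⁻¹ * z := by gcongr; exacts [hz.1.le, ht.2]
              _ = 1 := inv_mul_cancel₀ hz.1.ne'
          have h2 : Real.exp (-1) ≤ Real.exp (-t * z) := Real.exp_le_exp.2 (by linarith)
          unfold tricomiIntegrand
          rw [mul_assoc, mul_assoc]
          have ht0 : 0 < t := hsub ht
          exact mul_le_mul h2 (hle t ht.1.le) (by positivity) (Real.exp_pos _).le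
    _ ≤ tricomiInt b ν z :=
        setIntegral_mono_set hint (by
          filter_upwards [ae_restrict_mem measurableSet_Ioi] with t ht
          exact (tricomiIntegrand_pos b ν z ht).le) hsub.eventuallyLE

theorem tricomiIntegrand_add_natCast (b ν z : ℝ) (L : ℕ) {t : ℝ} (ht : 0 < t) :
    tricomiIntegrand b (ν + L) z t = ((1 + t)⁻¹) ^ L * tricomiIntegrand b ν z t := by
  unfold tricomiIntegrand
  rw [neg_add, Real.rpow_add (by positivity), Real.rpow_neg (by positivity) (L : ℝ),
    Real.rpow_natCast, inv_pow]
  ring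

theorem tricomiInt_add_one_le {b ν η : ℝ} (hb : 0 < b) (hη : 0 < η) :
    ∃ C : ℝ, ∀ z : ℝ, 0 < z → tricomiInt b (ν + 1) z ≤ η * tricomiInt b ν z + C := by
  obtain ⟨L, hL⟩ := exists_nat_gt (b - ν)
  refine ⟨(η ^ L)⁻¹ * tricomiInt b (ν + (L + 1 : ℕ)) 0, fun z hz => ?_⟩
  have hi := integrableOn_tricomiIntegrand ν hb hz
  have hi' := integrableOn_tricomiIntegrand (ν + (L + 1 : ℕ)) hb hz
  calc tricomiInt b (ν + 1) z
      ≤ ∫ t in Ioi (0:ℝ), (η * tricomiIntegrand b ν z t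
          + (η ^ L)⁻¹ * tricomiIntegrand b (ν + (L + 1 : ℕ)) z t) := by
        refine setIntegral_mono_on (integrableOn_tricomiIntegrand (ν + 1) hb hz)
          ((hi.const_mul η).add (hi'.const_mul _)) measurableSet_Ioi fun t ht => ?_
        have ht : 0 < t := ht
        have h1 := tricomiIntegrand_add_natCast b ν z 1 ht
        rw [Nat.cast_one, pow_one] at h1
        rw [h1, tricomiIntegrand_add_natCast b ν z (L + 1) ht]
        set u := (1 + t)⁻¹ with hu
        have hu0 : 0 < u := by positivity
        have hpos := tricomiIntegrand_pos b ν z ht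
        have hkey : u ≤ η + (η ^ L)⁻¹ * u ^ (L + 1) := by
          rcases le_total u η with h | h
          · have : 0 ≤ (η ^ L)⁻¹ * u ^ (L + 1) := by positivity
            linarith
          · have h2 : 1 ≤ (η ^ L)⁻¹ * u ^ L := by
              rw [inv_mul_eq_div, one_le_div (by positivity)]
              gcongr
            rw [pow_succ, ← mul_assoc]
            nlinarith
        nlinarith
    _ = η * tricomiInt b ν z + (η ^ L)⁻¹ * tricomiInt b (ν + (L + 1 : ℕ)) z := by
        rw [integral_add (hi.const_mul η) (hi'.const_mul _), integral_const_mul,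
          integral_const_mul]
        rfl
    _ ≤ _ := by
        gcongr
        exact tricomiInt_le_zero hb (by push_cast; linarith) hz

theorem tendsto_tricomiInt_add_one_div {b ν : ℝ} (hb : 0 < b) (hν : ν ≤ b) :
    Tendsto (fun z => tricomiInt b (ν + 1) z / tricomiInt b ν z) (𝓝[>] 0) (𝓝 0) := by
  rw [tendsto_order]
  refine ⟨fun a ha => ?_, fun a ha => ?_⟩
  · filter_upwards [self_mem_nhdsWithin] with z hz
    exact ha.trans (div_pos (tricomiInt_pos _ hb hz) (tricomiInt_pos _ hb hz))
  · obtain ⟨C, hC⟩ := tricomiInt_add_one_le (ν := ν) hb (half_pos ha)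
    filter_upwards [self_mem_nhdsWithin,
      (tendsto_tricomiInt_atTop hb hν).eventually_gt_atTop (C / (a / 2))] with z hz hz'
    rw [div_lt_iff₀ (tricomiInt_pos _ hb hz)]
    rw [div_lt_iff₀ (half_pos ha)] at hz'
    linarith [hC z hz]

theorem tendsto_pow_mul_tricomiInt {b ν : ℝ} (hb : 0 < b) (hν : b < ν) (k : ℕ) (hk : k ≠ 0) :
    Tendsto (fun z => z ^ k * tricomiInt b (ν - k) z) (𝓝[>] 0) (𝓝 0) := by
  have hcongr : ∀ z, z ^ k * tricomiInt b (ν - k) z =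
      ∫ t in Ioi (0:ℝ), (z * (1 + t)) ^ k * tricomiIntegrand b ν z t := by
    intro z
    unfold tricomiInt
    rw [← integral_const_mul]
    refine setIntegral_congr_fun measurableSet_Ioi fun t ht => ?_
    have ht : 0 < t := ht
    have h := tricomiIntegrand_add_natCast b (ν - k) z k ht
    rw [sub_add_cancel] at h
    simp only [h, mul_pow, inv_pow]
    have : (1 + t) ^ k ≠ 0 := by positivity
    field_simp
  simp only [hcongr]
  suffices h : Tendsto (fun z => ∫ t in Ioi (0:ℝ), (z * (1 + t)) ^ k * tricomiIntegrand b ν z t)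
      (𝓝[>] 0) (𝓝 (∫ t in Ioi (0:ℝ), (0:ℝ))) by rwa [integral_zero] at h
  refine tendsto_integral_filter_of_dominated_convergence
    (fun t => (k.factorial * Real.exp 1) * tricomiIntegrand b ν 0 t) ?_ ?_
    ((integrableOn_tricomiIntegrand_zero hb hν).const_mul _) ?_
  · refine Eventually.of_forall fun z => ?_
    exact (Continuous.aestronglyMeasurable (by fun_prop)).mul
      (aestronglyMeasurable_tricomiIntegrand b ν z)
  · filter_upwards [Ioo_mem_nhdsGT (zero_lt_one' ℝ)] with z hz
    filter_upwards [ae_restrict_mem measurableSet_Ioi] with t ht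
    have ht : 0 < t := ht
    have hz0 := hz.1
    have hpos := tricomiIntegrand_pos b ν z ht
    rw [Real.norm_of_nonneg (by positivity)]
    have h1 := Real.pow_div_factorial_le_exp (z * (1 + t)) (by positivity) k
    rw [div_le_iff₀ (by positivity)] at h1
    calc (z * (1 + t)) ^ k * tricomiIntegrand b ν z t
        ≤ (Real.exp (z * (1 + t)) * k.factorial) * tricomiIntegrand b ν z t := by gcongr
      _ = k.factorial * Real.exp z * tricomiIntegrand b ν 0 t := by
          unfold tricomiIntegrand
          rw [show z * (1 + t) = z + t * z by ring, Real.exp_add, neg_mul, Real.exp_neg]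
          simp only [mul_zero, Real.exp_zero]
          field_simp
      _ ≤ _ := by
          have := tricomiIntegrand_pos b ν 0 ht
          have := hz.2.le
          gcongr
  · filter_upwards [ae_restrict_mem measurableSet_Ioi] with t ht
    have hcont : Continuous fun z : ℝ => (z * (1 + t)) ^ k * tricomiIntegrand b ν z t := by
      unfold tricomiIntegrand
      fun_prop
    have h := (hcont.tendsto 0).mono_left (nhdsWithin_le_nhds (s := Ioi 0))
    simpa [hk] using h

theorem mul_tricomiInt_one_add (ν : ℝ) {z : ℝ} (hz : 0 < z) :
    z * tricomiInt 1 ν z + ν * tricomiInt 1 (ν + 1) z = 1 := by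
  have hi2 := (integrableOn_tricomiIntegrand ν one_pos hz).const_mul z
  have hi3 := (integrableOn_tricomiIntegrand (ν + 1) one_pos hz).const_mul ν
  have key := integral_Ioi_of_hasDerivAt_of_tendsto'
    (f := fun t : ℝ => -(Real.exp (-t * z) * (1 + t) ^ (-ν)))
    (f' := fun t : ℝ => z * tricomiIntegrand 1 ν z t
      + ν * tricomiIntegrand 1 (ν + 1) z t) (a := 0) (m := 0) ?_ (hi2.add hi3) ?_
  · rw [integral_add hi2 hi3, integral_const_mul, integral_const_mul] at key
    simpa [tricomiInt] using key
  · intro t ht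
    have ht : 0 ≤ t := ht
    have h1 : HasDerivAt (fun t : ℝ => Real.exp (-t * z)) (Real.exp (-t * z) * (-z)) t := by
      simpa using ((hasDerivAt_id t).neg.mul_const z).exp
    have h3 : HasDerivAt (fun t : ℝ => (1 + t) ^ (-ν)) (-ν * (1 + t) ^ (-ν - 1)) t := by
      have := ((hasDerivAt_id t).const_add 1).rpow_const (p := -ν) (Or.inl (by simp; positivity))
      simpa using this
    refine (h1.mul h3).neg.congr_deriv ?_
    simp only [tricomiIntegrand, sub_self, Real.rpow_zero]
    rw [show -(ν + 1) = -ν - 1 by ring]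
    ring
  · simpa using (tendsto_exp_neg_mul_one_add_rpow (-ν) hz).neg

theorem exists_tricomiInt_comb_neg {b ν : ℝ} (hb : -1 < b) (hb0 : b < 0) (hν : ν < 0) :
    ∃ z : ℝ, 0 < z ∧ z * tricomiInt (b + 1) ν z + ν * tricomiInt (b + 1) (ν + 1) z < 0 := by
  obtain ⟨s, hs, hs1, hsν, hs3⟩ : ∃ s : ℝ, s ^ b < min (1 / 2) (Real.exp (-1) * (-ν / 8)) ∧
      1 ≤ s ∧ -ν ≤ s ∧ 3 ≤ s := by
    have h := (tendsto_rpow_neg_atTop (y := -b) (by linarith)).eventually_lt_const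
      (u := min (1 / 2) (Real.exp (-1) * (-ν / 8)))
      (lt_min (by norm_num) (mul_pos (Real.exp_pos _) (by linarith)))
    rw [neg_neg] at h
    obtain ⟨s, h1, h2, h3, h4⟩ := (h.and ((eventually_ge_atTop 1).and
      ((eventually_ge_atTop (-ν)).and (eventually_ge_atTop 3)))).exists
    exact ⟨s, h1, h2, h3, h4⟩
  have hs0 : 0 < s := by linarith
  obtain ⟨z, hz, hzs⟩ : ∃ z : ℝ, 0 < z ∧ z * (1 + s) = -ν :=
    ⟨-ν / (1 + s), div_pos (by linarith) (by linarith), by field_simp⟩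
  refine ⟨z, hz, ?_⟩
  have hB : 0 < b + 1 := by linarith
  have hi1 := (integrableOn_tricomiIntegrand ν hB hz).const_mul z
  have hi2 := (integrableOn_tricomiIntegrand (ν + 1) hB hz).const_mul ν
  have hi3 := (integrableOn_tricomiIntegrand ν one_pos hz).const_mul z
  have hi4 := (integrableOn_tricomiIntegrand (ν + 1) one_pos hz).const_mul ν
  -- the integrand is the derivative of `exp (-t z) (1 + t) ^ (-ν)` times `s ^ b - t ^ b`
  set g : ℝ → ℝ := fun t => s ^ b * (z * tricomiIntegrand 1 ν z t
      + ν * tricomiIntegrand 1 (ν + 1) z t)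
      - (z * tricomiIntegrand (b + 1) ν z t + ν * tricomiIntegrand (b + 1) (ν + 1) z t) with hg
  have hgi : IntegrableOn g (Ioi 0) := ((hi3.add hi4).const_mul _).sub (hi1.add hi2)
  have hval : ∫ t in Ioi (0:ℝ), g t =
      s ^ b - (z * tricomiInt (b + 1) ν z + ν * tricomiInt (b + 1) (ν + 1) z) := by
    have h := integral_sub ((hi3.add hi4).const_mul (s ^ b)) (hi1.add hi2)
    simp only [Pi.add_apply] at h
    rw [h, integral_const_mul, integral_add hi3 hi4, integral_add hi1 hi2, integral_const_mul,
      integral_const_mul, integral_const_mul, integral_const_mul]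
    have := mul_tricomiInt_one_add ν hz
    unfold tricomiInt at this ⊢
    rw [this, mul_one]
  have hgeq : ∀ t, 0 < t → g t =
      Real.exp (-t * z) * (1 + t) ^ (-ν - 1) * ((-ν - z * (1 + t)) * (t ^ b - s ^ b)) := by
    intro t ht
    have h1 : (1 + t) ^ (-ν) = (1 + t) * (1 + t) ^ (-ν - 1) := by
      rw [mul_comm, ← Real.rpow_add_one (by positivity), sub_add_cancel]
    simp only [hg, tricomiIntegrand, sub_self, Real.rpow_zero, add_sub_cancel_right]
    rw [show -(ν + 1) = -ν - 1 by ring, h1]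
    ring
  have hnonneg : ∀ t, 0 < t → 0 ≤ g t := by
    intro t ht
    rw [hgeq t ht]
    refine mul_nonneg (by positivity) ?_
    rcases le_total t s with h | h
    · refine mul_nonneg ?_ (sub_nonneg.2 (Real.rpow_le_rpow_of_nonpos ht h hb0.le))
      nlinarith
    · refine mul_nonneg_of_nonpos_of_nonpos ?_
        (sub_nonpos.2 (Real.rpow_le_rpow_of_nonpos hs0 h hb0.le))
      nlinarith
  have hlow : ∀ t ∈ Ioc (0:ℝ) 1, Real.exp (-1) * (-ν / 8) ≤ g t := by
    intro t ht
    rw [hgeq t ht.1]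
    have hz1 : z ≤ 1 := by nlinarith
    have e1 : Real.exp (-1) ≤ Real.exp (-t * z) := Real.exp_le_exp.2 (by nlinarith [ht.1, ht.2])
    have e2 : 1 / 2 ≤ (1 + t) ^ (-ν - 1) := by
      calc (1:ℝ) / 2 ≤ (1 + t)⁻¹ := by
            rw [one_div]
            exact inv_anti₀ (by linarith [ht.1]) (by linarith [ht.2])
        _ = (1 + t) ^ (-1 : ℝ) := (Real.rpow_neg_one _).symm
        _ ≤ _ := Real.rpow_le_rpow_of_exponent_le (by linarith [ht.1]) (by linarith)
    have e3 : -ν / 2 ≤ -ν - z * (1 + t) := by nlinarith [ht.1, ht.2]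
    have e4 : 1 / 2 ≤ t ^ b - s ^ b := by
      have := Real.one_le_rpow_of_pos_of_le_one_of_nonpos ht.1 ht.2 hb0.le
      linarith [hs.trans_le (min_le_left _ _)]
    have e5 : (-ν / 2) * (1 / 2) ≤ (-ν - z * (1 + t)) * (t ^ b - s ^ b) :=
      mul_le_mul e3 e4 (by norm_num) (by linarith)
    calc Real.exp (-1) * (-ν / 8) = Real.exp (-1) * (1 / 2) * ((-ν / 2) * (1 / 2)) := by ring
      _ ≤ _ := mul_le_mul (mul_le_mul e1 e2 (by norm_num) (Real.exp_pos _).le) e5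
          (by nlinarith) (mul_nonneg (Real.exp_pos _).le (by linarith))
  have hge : Real.exp (-1) * (-ν / 8) ≤ ∫ t in Ioi (0:ℝ), g t := by
    calc Real.exp (-1) * (-ν / 8) = ∫ t in Ioc (0:ℝ) 1, Real.exp (-1) * (-ν / 8) := by simp
      _ ≤ ∫ t in Ioc (0:ℝ) 1, g t :=
        setIntegral_mono_on (integrableOn_const (by simp)) (hgi.mono_set Ioc_subset_Ioi_self)
          measurableSet_Ioc hlow
      _ ≤ ∫ t in Ioi (0:ℝ), g t :=
        setIntegral_mono_set hgi (by
          filter_upwards [ae_restrict_mem measurableSet_Ioi] with t ht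
          exact hnonneg t ht) Ioc_subset_Ioi_self.eventuallyLE
  linarith [hs.trans_le (min_le_right _ _)]

/-! ### The profile of the kernel and its continuation to `b > -1` -/

/-- The function `K` with `kernelT b d x y = K (x / y)`. -/
noncomputable def tricomiK (b ν z : ℝ) : ℝ := Real.exp (-z) * tricomiF b ν z

theorem tricomiK_eq (b ν z : ℝ) :
    tricomiK b ν z = Real.exp (-z) / Real.Gamma b * tricomiInt b ν z := by
  rw [tricomiK, tricomiF_eq]
  ring

theorem tricomiK_pos {b z : ℝ} (ν : ℝ) (hb : 0 < b) (hz : 0 < z) : 0 < tricomiK b ν z := by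
  rw [tricomiK_eq]
  have := Real.Gamma_pos_of_pos hb
  have := tricomiInt_pos ν hb hz
  positivity

theorem mul_tricomiK_add_one_left {b z : ℝ} (ν : ℝ) (hb : 0 < b) (hz : 0 < z) :
    b * tricomiK (b + 1) ν z = tricomiK b (ν - 1) z - tricomiK b ν z := by
  have := (Real.Gamma_pos_of_pos hb).ne'
  simp only [tricomiK_eq, Real.Gamma_add_one hb.ne', tricomiInt_add_one_left ν hb hz]
  field_simp

theorem tricomiK_add_one_lt {b z : ℝ} (ν : ℝ) (hb : 0 < b) (hz : 0 < z) :
    tricomiK b (ν + 1) z < tricomiK b ν z := by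
  simp only [tricomiK_eq]
  have := Real.Gamma_pos_of_pos hb
  exact mul_lt_mul_of_pos_left (tricomiInt_add_one_lt ν hb hz) (by positivity)

theorem hasDerivAt_tricomiK {b z : ℝ} (ν : ℝ) (hb : 0 < b) (hz : 0 < z) :
    HasDerivAt (tricomiK b ν) (-tricomiK b (ν - 1) z) z := by
  have h1 : HasDerivAt (fun z : ℝ => Real.exp (-z)) (Real.exp (-z) * -1) z := by
    simpa using (hasDerivAt_id z).neg.exp
  have h2 := h1.mul ((hasDerivAt_tricomiInt ν hb hz).const_mul (1 / Real.Gamma b))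
  refine h2.congr_deriv ?_
  rw [tricomiInt_add_one_left ν hb hz, tricomiK_eq]
  ring

/-- The profile `tricomiK b ν`, continued to `b > -1`. -/
noncomputable def tricomiH (b ν z : ℝ) : ℝ :=
  z * tricomiK (b + 1) ν z + ν * tricomiK (b + 1) (ν + 1) z

theorem tricomiH_eq_tricomiK {b z : ℝ} (ν : ℝ) (hb : 0 < b) (hz : 0 < z) :
    tricomiH b ν z = tricomiK b ν z := by
  have := (Real.Gamma_pos_of_pos hb).ne'
  have h := mul_tricomiInt ν hb hz
  simp only [tricomiH, tricomiK_eq, Real.Gamma_add_one hb.ne']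
  field_simp
  linarith

theorem hasDerivAt_tricomiH {b z : ℝ} (ν : ℝ) (hb : -1 < b) (hz : 0 < z) :
    HasDerivAt (tricomiH b ν) (-tricomiH b (ν - 1) z) z := by
  have hB : 0 < b + 1 := by linarith
  have h := ((hasDerivAt_id z).mul (hasDerivAt_tricomiK ν hB hz)).add
    ((hasDerivAt_tricomiK (ν + 1) hB hz).const_mul ν)
  refine h.congr_deriv ?_
  simp only [tricomiH, sub_add_cancel, add_sub_cancel_right, id]
  ring

theorem tricomiH_sub_one_left {b z : ℝ} (ν : ℝ) (hb : 0 < b) (hz : 0 < z) :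
    tricomiH (b - 1) ν z = (ν - b) * tricomiH b ν z + z * tricomiH b (ν - 1) z := by
  have h1 := mul_tricomiK_add_one_left ν hb hz
  have h2 := mul_tricomiK_add_one_left (ν + 1) hb hz
  have h3 := tricomiH_eq_tricomiK ν hb hz
  rw [tricomiH_eq_tricomiK ν hb hz, tricomiH_eq_tricomiK (ν - 1) hb hz]
  simp only [tricomiH, sub_add_cancel, add_sub_cancel_right] at *
  linear_combination z * h1 + ν * h2 - b * h3

theorem tricomiH_pos {b ν z : ℝ} (hb : -1 < b) (h : 0 < b ∨ 0 < ν) (hz : 0 < z) :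
    0 < tricomiH b ν z := by
  rcases h with h | h
  · rw [tricomiH_eq_tricomiK ν h hz]
    exact tricomiK_pos ν h hz
  · have hB : 0 < b + 1 := by linarith
    have := tricomiK_pos ν hB hz
    have := tricomiK_pos (ν + 1) hB hz
    unfold tricomiH
    positivity

theorem exists_tricomiH_pos {b : ℝ} (ν : ℝ) (hb : -1 < b) : ∃ z : ℝ, 0 < z ∧ 0 < tricomiH b ν z := by
  have hz : 0 < |ν| + 1 := by positivity
  have hB : 0 < b + 1 := by linarith
  refine ⟨|ν| + 1, hz, ?_⟩
  have h1 := tricomiK_add_one_lt ν hB hz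
  have h2 := tricomiK_pos (ν + 1) hB hz
  unfold tricomiH
  nlinarith [neg_abs_le ν, abs_nonneg ν]

theorem exists_tricomiH_neg {b ν : ℝ} (hb : -1 < b) (hb0 : b < 0) (hν : ν < 0) :
    ∃ z : ℝ, 0 < z ∧ tricomiH b ν z < 0 := by
  obtain ⟨z, hz, h⟩ := exists_tricomiInt_comb_neg hb hb0 hν
  refine ⟨z, hz, ?_⟩
  have hΓ : 0 < Real.Gamma (b + 1) := Real.Gamma_pos_of_pos (by linarith)
  have : tricomiH b ν z = Real.exp (-z) / Real.Gamma (b + 1) *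
      (z * tricomiInt (b + 1) ν z + ν * tricomiInt (b + 1) (ν + 1) z) := by
    simp only [tricomiH, tricomiK_eq]
    ring
  rw [this]
  exact mul_neg_of_pos_of_neg (by positivity) h

theorem tendsto_tricomiH_sub_one_left_div {b ν : ℝ} (hb : 0 < b) (hν : ν ≤ b) :
    Tendsto (fun z => tricomiH (b - 1) ν z / tricomiH b ν z) (𝓝[>] 0) (𝓝 0) := by
  have hid : Tendsto (fun z : ℝ => z) (𝓝[>] 0) (𝓝 0) := tendsto_id.mono_left nhdsWithin_le_nhds
  have h := hid.add ((tendsto_tricomiInt_add_one_div hb hν).const_mul ν)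
  rw [mul_zero, add_zero] at h
  refine h.congr' ?_
  filter_upwards [self_mem_nhdsWithin] with z hz
  rw [tricomiH_eq_tricomiK ν hb hz, tricomiH, sub_add_cancel, tricomiK_eq, tricomiK_eq]
  have := (tricomiInt_pos ν hb hz).ne'
  have := (Real.Gamma_pos_of_pos hb).ne'
  field_simp

theorem tendsto_mul_tricomiK {b ν : ℝ} (hb : 0 < b) (hν : b < ν) (k : ℕ) (hk : k ≠ 0) :
    Tendsto (fun z => z ^ k * tricomiK b (ν - k) z) (𝓝[>] 0) (𝓝 0) := by
  have hc : Continuous fun z : ℝ => Real.exp (-z) / Real.Gamma b := by fun_prop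
  have h := ((hc.tendsto 0).mono_left (nhdsWithin_le_nhds (s := Ioi 0))).mul
    (tendsto_pow_mul_tricomiInt hb hν k hk)
  rw [mul_zero] at h
  refine h.congr fun z => ?_
  rw [tricomiK_eq]
  ring

theorem tendsto_mul_tricomiH_sub_one_div {b ν : ℝ} (hb : -1 < b) (hν : 0 < ν) (hbν : b < ν) :
    Tendsto (fun z => z * tricomiH b (ν - 1) z / tricomiH b ν z) (𝓝[>] 0) (𝓝 0) := by
  have hB : 0 < b + 1 := by linarith
  have hBν : b + 1 < ν + 1 := by linarith
  have hnum : Tendsto (fun z => z * tricomiH b (ν - 1) z) (𝓝[>] 0) (𝓝 0) := by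
    have h := (tendsto_mul_tricomiK hB hBν 2 two_ne_zero).add
      ((tendsto_mul_tricomiK hB hBν 1 one_ne_zero).const_mul (ν - 1))
    rw [mul_zero, add_zero] at h
    refine h.congr fun z => ?_
    simp only [tricomiH, sub_add_cancel, Nat.cast_one, Nat.cast_ofNat, add_sub_cancel_right]
    rw [show ν + 1 - 2 = ν - 1 by ring]
    ring
  have hc : 0 < ν * (Real.exp (-1) / Real.Gamma (b + 1) * tricomiInt (b + 1) (ν + 1) 1) := by
    have := Real.Gamma_pos_of_pos hB
    have := tricomiInt_pos (ν + 1) hB one_pos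
    positivity
  have hlow : ∀ z ∈ Ioo (0:ℝ) 1, ν * (Real.exp (-1) / Real.Gamma (b + 1) *
      tricomiInt (b + 1) (ν + 1) 1) ≤ tricomiH b ν z := by
    intro z hz
    have h1 := tricomiInt_anti (ν + 1) hB hz.1 hz.2.le
    have h2 : Real.exp (-1) ≤ Real.exp (-z) := Real.exp_le_exp.2 (by linarith [hz.2])
    have h3 := tricomiInt_pos (ν + 1) hB one_pos
    have h4 := Real.Gamma_pos_of_pos hB
    have h5 : Real.exp (-1) / Real.Gamma (b + 1) * tricomiInt (b + 1) (ν + 1) 1 ≤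
        tricomiK (b + 1) (ν + 1) z := by
      rw [tricomiK_eq]
      gcongr
    have h6 := mul_pos hz.1 (tricomiK_pos ν hB hz.1)
    have h7 := mul_le_mul_of_nonneg_left h5 hν.le
    unfold tricomiH
    linarith
  have habs := hnum.abs.div_const
    (ν * (Real.exp (-1) / Real.Gamma (b + 1) * tricomiInt (b + 1) (ν + 1) 1))
  rw [abs_zero, zero_div] at habs
  refine squeeze_zero_norm' ?_ habs
  filter_upwards [Ioo_mem_nhdsGT (zero_lt_one' ℝ)] with z hz
  rw [norm_div, Real.norm_eq_abs, Real.norm_eq_abs]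
  have := (hlow z hz).trans (le_abs_self _)
  gcongr

/-! ### Chains of first order operators and sign changes of determinants -/

/-- `v` is positive on `(0, ∞)`, is sent to a function `w = o(v)` at `0` by an operator
`v ↦ e v - x v'`, and so on `N` times, until a function taking both signs is reached. -/
def SignChain : ℕ → (ℝ → ℝ) → Prop
  | 0, v => (∃ x, 0 < x ∧ v x < 0) ∧ ∃ x, 0 < x ∧ 0 < v x
  | N + 1, v => (∀ x, 0 < x → 0 < v x) ∧ ∃ (e : ℝ) (w : ℝ → ℝ),
      (∀ x, 0 < x → HasDerivAt v ((e * v x - w x) / x) x) ∧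
      Tendsto (fun x => w x / v x) (𝓝[>] 0) (𝓝 0) ∧ SignChain N w

/-- On `(0, ∞)`, `v` is a combination of the functions `x ^ k * g k x` with `k ≤ i`, `k < M`. -/
def EulerComb (g : ℕ → ℝ → ℝ) (M i : ℕ) (v : ℝ → ℝ) : Prop :=
  ∃ c : ℕ → ℝ, (∀ k, i < k → c k = 0) ∧
    ∀ x, 0 < x → v x = ∑ k ∈ Finset.range M, c k * (x ^ k * g k x)

theorem EulerComb.step {g : ℕ → ℝ → ℝ} (hg : ∀ k x, 0 < x → HasDerivAt (g k) (g (k + 1) x) x)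
    {M i : ℕ} (hi : i + 1 < M) {v w : ℝ → ℝ} {e : ℝ} (hv : EulerComb g M i v)
    (hw : ∀ x, 0 < x → HasDerivAt v ((e * v x - w x) / x) x) : EulerComb g M (i + 1) w := by
  obtain ⟨c, hc, hvc⟩ := hv
  obtain ⟨M, rfl⟩ : ∃ M', M = M' + 1 := ⟨M - 1, by omega⟩
  refine ⟨fun k => Nat.casesOn k (e * c 0) fun k => (e - (k + 1)) * c (k + 1) - c k, ?_, ?_⟩
  · rintro (_ | k) hk
    · omega
    · simp [hc k (by omega), hc (k + 1) (by omega)]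
  · intro x hx
    have hterm : ∀ k, HasDerivAt (fun x => c k * (x ^ k * g k x))
        (c k * (k * x ^ (k - 1) * g k x + x ^ k * g (k + 1) x)) x := fun k =>
      ((hasDerivAt_pow k x).mul (hg k x hx)).const_mul (c k)
    have hsum : HasDerivAt v (∑ k ∈ Finset.range (M + 1),
        c k * (k * x ^ (k - 1) * g k x + x ^ k * g (k + 1) x)) x := by
      refine (HasDerivAt.fun_sum fun k _ => hterm k).congr_of_eventuallyEq ?_
      filter_upwards [Ioi_mem_nhds hx] with y hy using hvc y hy
    have hx' : ∀ k : ℕ, x * (k * x ^ (k - 1) * g k x) = k * (x ^ k * g k x) := by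
      rintro (_ | k)
      · simp
      · simp only [Nat.add_sub_cancel, pow_succ]
        ring
    have hmul := (hw x hx).unique hsum
    rw [div_eq_iff hx.ne'] at hmul
    have hweq : w x = ∑ k ∈ Finset.range (M + 1), (e - k) * c k * (x ^ k * g k x)
        - ∑ k ∈ Finset.range (M + 1), c k * (x ^ (k + 1) * g (k + 1) x) := by
      have : w x = e * v x - (∑ k ∈ Finset.range (M + 1),
        c k * (k * x ^ (k - 1) * g k x + x ^ k * g (k + 1) x)) * x := by linarith
      rw [this, hvc x hx, Finset.mul_sum, Finset.sum_mul, ← Finset.sum_sub_distrib,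
        ← Finset.sum_sub_distrib]
      refine Finset.sum_congr rfl fun k _ => ?_
      linear_combination (-(c k)) * hx' k
    rw [hweq, Finset.sum_range_succ', Finset.sum_range_succ _ M, hc M (by omega),
      Finset.sum_range_succ', zero_mul, add_zero, add_sub_right_comm, ← Finset.sum_sub_distrib]
    congr 1
    · refine Finset.sum_congr rfl fun k _ => ?_
      push_cast
      ring
    · simp

/-- The determinant of a family headed by a dominating function is governed by its first minor. -/
theorem exists_cons_det_pos {N : ℕ} {u : ℕ → ℝ → ℝ}
    (hpos : ∀ x, 0 < x → 0 < u 0 x)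
    (hlim : ∀ j ≤ N, Tendsto (fun x => u (j + 1) x / u 0 x) (𝓝[>] 0) (𝓝 0))
    {σ : ℝ} {x : Fin (N + 1) → ℝ} (hx : StrictMono x) (hx0 : ∀ i, 0 < x i)
    (hdet : 0 < σ * (Matrix.of fun i j : Fin (N + 1) => u (j + 1) (x i)).det) :
    ∃ x' : Fin (N + 2) → ℝ, StrictMono x' ∧ (∀ i, 0 < x' i) ∧
      0 < σ * (Matrix.of fun i j : Fin (N + 2) => u j (x' i)).det := by
  set m : Fin (N + 2) → ℝ := fun j =>
    (Matrix.of fun i k : Fin (N + 1) => u (j.succAbove k) (x i)).det with hm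
  have hexp : ∀ a, (Matrix.of fun i j : Fin (N + 2) => u j (Fin.cons a x i : ℝ)).det =
      ∑ j : Fin (N + 2), (-1) ^ (j : ℕ) * u j a * m j := by
    intro a
    rw [Matrix.det_succ_row_zero]
    rfl
  have hm0 : m 0 = (Matrix.of fun i j : Fin (N + 1) => u (j + 1) (x i)).det := by
    simp [hm]
  have hlim' : Tendsto (fun a => σ * ∑ j : Fin (N + 2), (-1) ^ (j : ℕ) * (u j a / u 0 a) * m j) (𝓝[>] 0)
      (𝓝 (σ * m 0)) := by
    refine Tendsto.const_mul σ ?_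
    have h : Tendsto (fun a => ∑ j : Fin (N + 2), (-1) ^ (j : ℕ) * (u j a / u 0 a) * m j)
        (𝓝[>] 0) (𝓝 (∑ j : Fin (N + 2), if j = 0 then m j else 0)) := by
      refine tendsto_finsetSum _ fun j _ => ?_
      cases j using Fin.cases with
      | zero =>
        refine Tendsto.congr' ?_ tendsto_const_nhds
        filter_upwards [self_mem_nhdsWithin] with a ha
        simp [div_self (hpos a ha).ne']
      | succ j =>
        have := ((hlim j (by omega)).const_mul ((-1) ^ (j.succ : ℕ))).mul_const (m j.succ)
        simpa [Fin.succ_ne_zero] using this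
    simpa using h
  rw [← hm0] at hdet
  have hIoo : ∀ᶠ a in 𝓝[>] (0:ℝ), a ∈ Ioo 0 (x 0) := Ioo_mem_nhdsGT (hx0 0)
  obtain ⟨a, ⟨ha0, hax⟩, ha⟩ := (hIoo.and (hlim'.eventually_const_lt hdet)).exists
  refine ⟨Fin.cons a x, ?_, ?_, ?_⟩
  · exact hx.vecCons hax
  · intro i
    cases i using Fin.cases with
    | zero => exact ha0
    | succ i => exact hx0 i
  · rw [hexp]
    have : ∑ j : Fin (N + 2), (-1) ^ (j : ℕ) * u j a * m j =
        u 0 a * ∑ j : Fin (N + 2), (-1) ^ (j : ℕ) * (u j a / u 0 a) * m j := by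
      rw [Finset.mul_sum]
      refine Finset.sum_congr rfl fun j _ => ?_
      have := (hpos a ha0).ne'
      field_simp
    rw [this, mul_left_comm]
    exact mul_pos (hpos a ha0) ha

theorem SignChain.exists_det_pos {g : ℕ → ℝ → ℝ}
    (hg : ∀ k x, 0 < x → HasDerivAt (g k) (g (k + 1) x) x) {M : ℕ} :
    ∀ {N i : ℕ} {v : ℝ → ℝ}, SignChain N v → EulerComb g M i v → i + N < M →
    ∃ u : ℕ → ℝ → ℝ, u 0 = v ∧ (∀ j ≤ N, EulerComb g M (i + j) (u j)) ∧
      (∀ j ≤ N, u j =O[𝓝[>] 0] v) ∧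
      ∀ σ : ℝ, σ ≠ 0 → ∃ x : Fin (N + 1) → ℝ, StrictMono x ∧ (∀ i, 0 < x i) ∧
        0 < σ * (Matrix.of fun i j : Fin (N + 1) => u j (x i)).det
  | 0, i, v, hv, hc, hM => by
    obtain ⟨⟨x, hx, hxv⟩, y, hy, hyv⟩ := hv
    refine ⟨fun _ => v, rfl, ?_, fun _ _ => Asymptotics.isBigO_refl _ _, fun σ hσ => ?_⟩
    · intro j hj
      obtain rfl : j = 0 := by omega
      exact hc
    · rcases lt_or_gt_of_ne hσ with h | h
      · refine ⟨fun _ => x, Subsingleton.strictMono (α := Fin 1) _, fun _ => hx, ?_⟩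
        simpa using mul_pos_of_neg_of_neg h hxv
      · refine ⟨fun _ => y, Subsingleton.strictMono (α := Fin 1) _, fun _ => hy, ?_⟩
        simpa using mul_pos h hyv
  | N + 1, i, v, hv, hc, hM => by
    obtain ⟨hpos, e, w, hw, hlim, hchain⟩ := hv
    obtain ⟨u, hu0, huc, huO, hu⟩ := hchain.exists_det_pos hg (hc.step hg (by omega) hw) (by omega)
    have hwo : w =o[𝓝[>] 0] v := by
      refine (Asymptotics.isLittleO_iff_tendsto' ?_).2 hlim
      filter_upwards [self_mem_nhdsWithin] with x hx h0 using absurd h0 (hpos x hx).ne'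
    have huo : ∀ j ≤ N, u j =o[𝓝[>] 0] v := fun j hj => (huO j hj).trans_isLittleO hwo
    refine ⟨fun j => Nat.casesOn j v u, rfl, ?_, ?_, fun σ hσ => ?_⟩
    · rintro (_ | j) hj
      · exact hc
      · rw [show i + (j + 1) = i + 1 + j by ring]
        exact huc j (by omega)
    · rintro (_ | j) hj
      · exact Asymptotics.isBigO_refl _ _
      · exact (huo j (by omega)).isBigO
    · obtain ⟨x, hx, hx0, hdet⟩ := hu σ hσ
      exact exists_cons_det_pos (u := fun j => Nat.casesOn j v u) hpos
        (fun j hj => (huo j hj).tendsto_div_nhds_zero) hx hx0 hdet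

/-- The determinants of the scaled derivatives `x ^ k * g k x` take both signs. -/
theorem SignChain.exists_wronskian_det_pos {g : ℕ → ℝ → ℝ}
    (hg : ∀ k x, 0 < x → HasDerivAt (g k) (g (k + 1) x) x) {N : ℕ} (h : SignChain N (g 0))
    {σ : ℝ} (hσ : σ ≠ 0) :
    ∃ x : Fin (N + 1) → ℝ, StrictMono x ∧ (∀ i, 0 < x i) ∧
      0 < σ * (Matrix.of fun i k : Fin (N + 1) => x i ^ (k : ℕ) * g k (x i)).det := by
  have h0 : EulerComb g (N + 1) 0 (g 0) := by
    refine ⟨fun k => if k = 0 then 1 else 0, fun k hk => by simp [hk.ne'], fun x _ => ?_⟩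
    simp
  obtain ⟨u, -, huc, -, hu⟩ := h.exists_det_pos hg h0 (by omega)
  choose! c _ hc using huc
  set C : Matrix (Fin (N + 1)) (Fin (N + 1)) ℝ := Matrix.of fun k j => c j k with hC
  have hfac : ∀ x : Fin (N + 1) → ℝ, (∀ i, 0 < x i) →
      (Matrix.of fun i j : Fin (N + 1) => u j (x i)).det =
      (Matrix.of fun i k : Fin (N + 1) => x i ^ (k : ℕ) * g k (x i)).det * C.det := by
    intro x hx
    rw [← Matrix.det_mul]
    congr 1
    ext i j
    simp only [Matrix.of_apply, Matrix.mul_apply, hC]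
    rw [hc j (by omega) (x i) (hx i), Finset.sum_range]
    exact Finset.sum_congr rfl fun k _ => mul_comm _ _
  have hC0 : C.det ≠ 0 := by
    obtain ⟨x, -, hx, hd⟩ := hu 1 one_ne_zero
    rw [hfac x hx] at hd
    rintro h0
    simp [h0] at hd
  obtain ⟨x, hx, hx0, hd⟩ := hu (σ * C.det) (mul_ne_zero hσ hC0)
  refine ⟨x, hx, hx0, ?_⟩
  rw [hfac x hx0] at hd
  exact (mul_pos_iff_of_pos_right (mul_self_pos.2 hC0)).1 (by linarith)

/-! ### Confluent limits of determinants -/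

theorem iteratedDerivWithin_Ioi_eq {g : ℕ → ℝ → ℝ}
    (hg : ∀ k x, 0 < x → HasDerivAt (g k) (g (k + 1) x) x) (k : ℕ) :
    ∀ x ∈ Ioi (0:ℝ), iteratedDerivWithin k (g 0) (Ioi 0) x = g k x := by
  induction k with
  | zero => simp
  | succ k ih =>
    intro x hx
    rw [iteratedDerivWithin_succ, derivWithin_congr ih (ih x hx)]
    exact (hg k x hx).hasDerivWithinAt.derivWithin (uniqueDiffOn_Ioi 0 x hx)

theorem isLittleO_sub_taylor {g : ℕ → ℝ → ℝ}
    (hg : ∀ k x, 0 < x → HasDerivAt (g k) (g (k + 1) x) x) (N : ℕ) {a : ℝ} (ha : 0 < a) :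
    (fun h => g 0 (a + h) - ∑ k ∈ Finset.range (N + 1), g k a * h ^ k / k.factorial)
      =o[𝓝 0] fun h => h ^ N := by
  have hcont : ContDiffOn ℝ N (g 0) (Ioi 0) := by
    refine contDiffOn_of_differentiableOn_deriv (n := N) fun m _ x hx => ?_
    refine ((hg m x hx).differentiableAt.differentiableWithinAt).congr
      (iteratedDerivWithin_Ioi_eq hg m) (iteratedDerivWithin_Ioi_eq hg m x hx)
  have h := taylor_isLittleO (convex_Ioi (0:ℝ)) ha hcont
  rw [isOpen_Ioi.nhdsWithin_eq ha] at h
  have hlim : Tendsto (fun h => a + h) (𝓝 0) (𝓝 a) := by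
    simpa using (tendsto_const_nhds (x := a)).add (tendsto_id (x := 𝓝 (0:ℝ)))
  refine (h.comp_tendsto hlim).congr (fun h => ?_) fun h => by simp
  simp only [Function.comp, taylor_within_apply, add_sub_cancel_left, smul_eq_mul]
  congr 1
  refine Finset.sum_congr rfl fun k _ => ?_
  rw [iteratedDerivWithin_Ioi_eq hg k a ha]
  ring

/-- Column operations turning values at `1 + j t` into derivatives at `1`, as `t → 0`. -/
noncomputable def confluentMatrix (N : ℕ) (t : ℝ) : Matrix (Fin (N + 1)) (Fin (N + 1)) ℝ :=
  Matrix.of fun j k => (Matrix.vandermonde fun j : Fin (N + 1) => (j : ℝ)).transpose⁻¹ j k *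
    (k : ℕ).factorial / t ^ (k : ℕ)

theorem sum_pow_mul_confluentMatrix (N : ℕ) {t : ℝ} (ht : t ≠ 0) (k l : Fin (N + 1)) :
    ∑ j : Fin (N + 1), (j * t) ^ (l : ℕ) / (l : ℕ).factorial * confluentMatrix N t j k =
      if l = k then 1 else 0 := by
  set V := (Matrix.vandermonde fun j : Fin (N + 1) => (j : ℝ)).transpose with hV
  have hdet : IsUnit V.det := by
    rw [hV, Matrix.det_transpose, isUnit_iff_ne_zero, Matrix.det_vandermonde_ne_zero_iff]
    intro i j hij
    simpa [Fin.ext_iff] using hij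
  have h : (V * V⁻¹) l k = if l = k then 1 else 0 := by
    rw [Matrix.mul_nonsing_inv _ hdet, Matrix.one_apply]
  rw [Matrix.mul_apply] at h
  have hsum : ∑ j : Fin (N + 1), (j * t) ^ (l : ℕ) / (l : ℕ).factorial * confluentMatrix N t j k =
      (∑ j, V l j * V⁻¹ j k) *
        (t ^ (l : ℕ) / (l : ℕ).factorial * ((k : ℕ).factorial / t ^ (k : ℕ))) := by
    rw [Finset.sum_mul]
    refine Finset.sum_congr rfl fun j _ => ?_
    simp only [confluentMatrix, Matrix.of_apply, ← hV]
    rw [show V l j = (j : ℝ) ^ (l : ℕ) from rfl, mul_pow]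
    ring
  rw [hsum, h]
  split_ifs with hlk
  · subst hlk
    field_simp
  · ring

theorem tendsto_mul_confluentMatrix {g : ℕ → ℝ → ℝ}
    (hg : ∀ k x, 0 < x → HasDerivAt (g k) (g (k + 1) x) x) {N : ℕ} {x : Fin (N + 1) → ℝ}
    (hx : ∀ i, 0 < x i) :
    Tendsto (fun t : ℝ => (Matrix.of fun i j : Fin (N + 1) => g 0 (x i * (1 + j * t))) *
      confluentMatrix N t) (𝓝[<] 0)
      (𝓝 (Matrix.of fun i k : Fin (N + 1) => x i ^ (k : ℕ) * g k (x i))) := by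
  refine tendsto_pi_nhds.2 fun i => tendsto_pi_nhds.2 fun k => ?_
  set R : Fin (N + 1) → ℝ → ℝ := fun j t => g 0 (x i * (1 + j * t)) -
    ∑ l ∈ Finset.range (N + 1), g l (x i) * (x i * j * t) ^ l / l.factorial with hR
  have hRo : ∀ j, R j =o[𝓝[<] 0] fun t => t ^ (k : ℕ) := by
    intro j
    have hcont : Continuous fun t : ℝ => x i * j * t := by fun_prop
    have hlim : Tendsto (fun t : ℝ => x i * j * t) (𝓝[<] 0) (𝓝 0) := by
      simpa using (hcont.tendsto 0).mono_left (nhdsWithin_le_nhds (s := Iio 0))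
    have h1 := (isLittleO_sub_taylor hg N (hx i)).comp_tendsto hlim
    have h2 : (fun t : ℝ => (x i * j * t) ^ N) =O[𝓝[<] 0] fun t => t ^ N := by
      simp only [mul_pow]
      exact Asymptotics.isBigO_const_mul_self _ _ _
    have h3 : (fun t : ℝ => t ^ N) =O[𝓝[<] 0] fun t => t ^ (k : ℕ) :=
      Asymptotics.IsBigO.of_bound' <| by
        filter_upwards [Ioo_mem_nhdsLT (show (-1:ℝ) < 0 by norm_num)] with t ht
        rw [norm_pow, norm_pow]
        refine pow_le_pow_of_le_one (norm_nonneg t) ?_ (Nat.lt_succ_iff.1 k.2)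
        rw [Real.norm_eq_abs, abs_le]
        constructor <;> linarith [ht.1, ht.2]
    refine ((h1.trans_isBigO h2).trans_isBigO h3).congr_left fun t => ?_
    simp only [hR, Function.comp]
    rw [show x i * (1 + j * t) = x i + x i * j * t by ring]
  have hzero : Tendsto (fun t => ∑ j, R j t * confluentMatrix N t j k) (𝓝[<] 0) (𝓝 0) := by
    suffices Tendsto (fun t => ∑ j, R j t * confluentMatrix N t j k) (𝓝[<] 0)
        (𝓝 (∑ _j : Fin (N + 1), 0)) by simpa using this
    refine tendsto_finsetSum _ fun j _ => ?_
    have h := (hRo j).tendsto_div_nhds_zero.mul_const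
      ((Matrix.vandermonde fun j : Fin (N + 1) => (j : ℝ)).transpose⁻¹ j k * (k : ℕ).factorial)
    rw [zero_mul] at h
    refine h.congr fun t => ?_
    simp only [confluentMatrix, Matrix.of_apply]
    ring
  have hadd := hzero.add_const (x i ^ (k : ℕ) * g k (x i))
  rw [zero_add] at hadd
  refine hadd.congr' ?_
  filter_upwards [self_mem_nhdsWithin] with t ht
  have ht : t ≠ 0 := ne_of_lt ht
  have hmain : ∑ j : Fin (N + 1), (∑ l ∈ Finset.range (N + 1),
      g l (x i) * (x i * j * t) ^ l / l.factorial) * confluentMatrix N t j k =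
      x i ^ (k : ℕ) * g k (x i) := by
    simp only [Finset.sum_range, Finset.sum_mul]
    rw [Finset.sum_comm]
    have : ∀ l : Fin (N + 1), ∑ j : Fin (N + 1), g l (x i) * (x i * j * t) ^ (l : ℕ) /
        (l : ℕ).factorial * confluentMatrix N t j k =
        (x i ^ (l : ℕ) * g l (x i)) * if l = k then 1 else 0 := by
      intro l
      rw [← sum_pow_mul_confluentMatrix N ht k l, Finset.mul_sum]
      refine Finset.sum_congr rfl fun j _ => ?_
      rw [mul_assoc (x i), mul_pow (x i)]
      ring
    simp [this]
  rw [Matrix.mul_apply, ← hmain, ← Finset.sum_add_distrib]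
  refine Finset.sum_congr rfl fun j _ => ?_
  simp only [hR, Matrix.of_apply]
  ring

theorem SignChain.exists_det_neg {g : ℕ → ℝ → ℝ}
    (hg : ∀ k x, 0 < x → HasDerivAt (g k) (g (k + 1) x) x) {N : ℕ} (h : SignChain N (g 0))
    {σ : ℝ} (hσ : σ ≠ 0) :
    ∃ x s : Fin (N + 1) → ℝ, StrictMono x ∧ StrictAnti s ∧ (∀ i, 0 < x i) ∧ (∀ i, 0 < s i) ∧
      σ * (Matrix.of fun i j => g 0 (x i * s j)).det < 0 := by
  obtain ⟨x, hx, hx0, hxd⟩ := h.exists_wronskian_det_pos hg one_ne_zero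
  obtain ⟨y, hy, hy0, hyd⟩ := h.exists_wronskian_det_pos hg (neg_ne_zero.2 one_ne_zero)
  have hdet : Continuous fun A : Matrix (Fin (N + 1)) (Fin (N + 1)) ℝ => A.det :=
    continuous_id.matrix_det
  have hxl := (hdet.tendsto _).comp (tendsto_mul_confluentMatrix hg hx0)
  have hyl := (hdet.tendsto _).comp (tendsto_mul_confluentMatrix hg hy0)
  have hIoo : ∀ᶠ t in 𝓝[<] (0:ℝ), t ∈ Ioo (-(1 / ((N : ℝ) + 1))) 0 :=
    Ioo_mem_nhdsLT (neg_lt_zero.2 (by positivity))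
  obtain ⟨t, ht, htx, hty⟩ := (hIoo.and ((hxl.eventually_const_lt (one_mul (_ : ℝ) ▸ hxd)).and
      (hyl.eventually_lt_const (by linarith : _ < (0:ℝ))))).exists
  simp only [Function.comp, Matrix.det_mul] at htx hty
  have hs : StrictAnti fun j : Fin (N + 1) => 1 + (j : ℝ) * t := by
    intro i j hij
    have : (i : ℝ) < j := by exact_mod_cast hij
    simp only
    nlinarith [ht.2]
  have hs0 : ∀ j : Fin (N + 1), 0 < 1 + (j : ℝ) * t := by
    intro j
    have h1 : (j : ℝ) ≤ N := by exact_mod_cast Nat.lt_succ_iff.1 j.2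
    have h2 : -1 < t * (N + 1) := by
      have := ht.1
      rw [← neg_div, div_lt_iff₀ (by positivity)] at this
      exact this
    nlinarith [ht.2]
  set A := (Matrix.of fun i j : Fin (N + 1) => g 0 (x i * (1 + j * t))).det
  set B := (Matrix.of fun i j : Fin (N + 1) => g 0 (y i * (1 + j * t))).det
  set E := (confluentMatrix N t).det
  by_cases hA : σ * A < 0
  · exact ⟨x, _, hx, hs, hx0, hs0, hA⟩
  · refine ⟨y, _, hy, hs, hy0, hs0, ?_⟩
    change σ * B < 0
    by_contra! hB
    push Not at hA
    have hAB : 0 ≤ σ ^ 2 * (A * B) := by nlinarith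
    have hAB' : A * B < 0 := by
      have : (A * B) * (E * E) < 0 := by nlinarith
      exact neg_of_mul_neg_left this (mul_self_nonneg E)
    have : 0 < σ ^ 2 := by positivity
    nlinarith

/-! ### The Tricomi kernel below the staircase -/

theorem signChain_tricomiH : ∀ (N : ℕ) {b d : ℝ} (r : ℕ) {p q : ℕ}, p + q = N → -1 < b →
    (∀ k : ℕ, b ≠ k) → (∀ k : ℕ, d ≠ k) → b < q → q < b + 1 → d < p → (p = 0 ∨ (p : ℝ) - 1 < d) →
    SignChain N fun z => z ^ r * tricomiH b d z
  | 0, b, d, r, p, q, hN, hb, _, _, hbq, _, hdp, _ => by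
    obtain ⟨rfl, rfl⟩ : p = 0 ∧ q = 0 := by omega
    rw [Nat.cast_zero] at hbq hdp
    obtain ⟨x, hx, hxneg⟩ := exists_tricomiH_neg hb hbq hdp
    obtain ⟨y, hy, hypos⟩ := exists_tricomiH_pos d hb
    exact ⟨⟨x, hx, mul_neg_of_pos_of_neg (pow_pos hx r) hxneg⟩, y, hy, by positivity⟩
  | N + 1, b, d, r, p, q, hN, hb, hbn, hdn, hbq, hqb, hdp, hpd => by
    have hderiv : ∀ x, 0 < x → HasDerivAt (fun z => z ^ r * tricomiH b d z)
        (r * x ^ (r - 1) * tricomiH b d x + x ^ r * -tricomiH b (d - 1) x) x := fun x hx =>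
      (hasDerivAt_pow r x).mul (hasDerivAt_tricomiH d hb hx)
    have hpow : ∀ x : ℝ, r * x ^ (r - 1) * x = r * x ^ r := by
      intro x
      rcases r with _ | r
      · simp
      · simp [pow_succ, mul_assoc]
    have hdiv : ∀ w : ℝ → ℝ, ∀ x : ℝ, 0 < x →
        x ^ r * w x / (x ^ r * tricomiH b d x) = w x / tricomiH b d x := fun w x hx =>
      mul_div_mul_left _ _ (pow_pos hx r).ne'
    by_cases hbd : 0 < b ∧ d ≤ b
    · obtain ⟨hb0, hdb⟩ := hbd
      have hq : 0 < q := by exact_mod_cast hb0.trans hbq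
      obtain ⟨q, rfl⟩ := Nat.exists_eq_succ_of_ne_zero hq.ne'
      push_cast at hbq hqb
      refine ⟨fun x hx => mul_pos (pow_pos hx r) (tricomiH_pos hb (Or.inl hb0) hx),
        r + d - b, fun z => z ^ r * tricomiH (b - 1) d z, fun x hx => ?_, ?_,
        signChain_tricomiH N r (p := p) (q := q) (by omega) (by linarith) (fun k hk => ?_) hdn
          (by linarith) (by linarith) hdp hpd⟩
      · convert hderiv x hx using 1
        rw [div_eq_iff hx.ne']
        beta_reduce
        rw [tricomiH_sub_one_left d hb0 hx]
        linear_combination (-(tricomiH b d x)) * hpow x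
      · refine (tendsto_tricomiH_sub_one_left_div hb0 hdb).congr' ?_
        filter_upwards [self_mem_nhdsWithin] with x hx
        exact (hdiv _ x hx).symm
      · exact hbn (k + 1) (by push_cast; linarith)
    · have hd : 0 < d ∧ b < d := by
        by_cases hb0 : 0 < b
        · have : b < d := not_le.1 fun h => hbd ⟨hb0, h⟩
          exact ⟨hb0.trans this, this⟩
        · have hb0 : b < 0 := lt_of_le_of_ne (not_lt.1 hb0) (by simpa using hbn 0)
          have hq : (q : ℝ) < 1 := by linarith
          have hq : q < 1 := by exact_mod_cast hq
          have hp : (1 : ℝ) ≤ p := by exact_mod_cast (by omega : 1 ≤ p)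
          have : 0 < d := by
            rcases hpd with h | h
            · omega
            · linarith
          exact ⟨this, hb0.trans this⟩
      have hp : 0 < p := by exact_mod_cast hd.1.trans hdp
      obtain ⟨p, rfl⟩ := Nat.exists_eq_succ_of_ne_zero hp.ne'
      push_cast at hdp
      refine ⟨fun x hx => mul_pos (pow_pos hx r) (tricomiH_pos hb (Or.inr hd.1) hx),
        r, fun z => z ^ (r + 1) * tricomiH b (d - 1) z, fun x hx => ?_, ?_,
        signChain_tricomiH N (r + 1) (p := p) (q := q) (by omega) hb hbn (fun k hk => ?_)
          hbq hqb (by linarith) (Or.inr ?_)⟩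
      · convert hderiv x hx using 1
        rw [div_eq_iff hx.ne']
        linear_combination (-(tricomiH b d x)) * hpow x
      · refine (tendsto_mul_tricomiH_sub_one_div hb hd.1 hd.2).congr' ?_
        filter_upwards [self_mem_nhdsWithin] with x hx
        rw [pow_succ, mul_assoc]
        exact (hdiv (fun x => x * tricomiH b (d - 1) x) x hx).symm
      · exact hdn (k + 1) (by push_cast; linarith)
      · have := hpd.resolve_left (Nat.succ_ne_zero p)
        push_cast at this
        linarith

/-- If `(d,b)` lies below the staircase `E_n`, then `T_{b,d}` is not sign regular
of order `n+1`. -/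
theorem kernelT_not_SR_below_staircase (n : ℕ) (hn : 1 ≤ n) (b d : ℝ) (hb : 0 < b)
    (hbnat : ¬ ∃ k : ℕ, b = k + 1) (hdnat : ¬ ∃ k : ℕ, d = k)
    (hbelow : ∃ k : ℕ, k < n ∧ d < (k : ℝ) ∧ b < (n : ℝ) - k)
    (ε : ℕ → ℝ) (hε : ∀ i, ε i = -1 ∨ ε i = 1) :
    ∃ m : ℕ, 1 ≤ m ∧ m ≤ n + 1 ∧ ∃ x y : Fin m → ℝ,
      StrictMono x ∧ StrictMono y ∧ (∀ i, 0 < x i) ∧ (∀ i, 0 < y i) ∧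
      ε m * Matrix.det (Matrix.of fun i j => kernelT b d (x i) (y j)) < 0 := by
  obtain ⟨k, hkn, hdk, hbk⟩ := hbelow
  have hp : ⌈d⌉₊ ≤ k := Nat.ceil_le.2 hdk.le
  have hq : ⌈b⌉₊ ≤ n - k := Nat.ceil_le.2 (by rw [Nat.cast_sub hkn.le]; exact hbk.le)
  have hbn : ∀ k : ℕ, b ≠ k := by
    rintro (_ | k) h
    · simp [h] at hb
    · exact hbnat ⟨k, by exact_mod_cast h⟩
  have hdn : ∀ k : ℕ, d ≠ k := fun k h => hdnat ⟨k, h⟩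
  set g : ℕ → ℝ → ℝ := fun k x => (-1) ^ k * tricomiH b (d - k) x with hg
  have hderiv : ∀ k x, 0 < x → HasDerivAt (g k) (g (k + 1) x) x := by
    intro k x hx
    have hk : g (k + 1) x = (-1) ^ k * -tricomiH b (d - k - 1) x := by
      simp only [hg, pow_succ, Nat.cast_add, Nat.cast_one, sub_add_eq_sub_sub]
      ring
    rw [hk]
    exact (hasDerivAt_tricomiH (d - k) (by linarith) hx).const_mul ((-1) ^ k)
  have hg0 : g 0 = tricomiH b d := by
    funext x
    simp [hg]
  have hchain : SignChain (⌈d⌉₊ + ⌈b⌉₊) (g 0) := by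
    have hpd : ⌈d⌉₊ = 0 ∨ (⌈d⌉₊ : ℝ) - 1 < d := by
      rcases le_or_gt d 0 with h | h
      · exact Or.inl (Nat.ceil_eq_zero.2 h)
      · exact Or.inr (by linarith [Nat.ceil_lt_add_one h.le])
    simpa [hg0] using signChain_tricomiH _ 0 rfl (by linarith) hbn hdn
      (lt_of_le_of_ne (Nat.le_ceil b) (hbn _)) (Nat.ceil_lt_add_one hb.le)
      (lt_of_le_of_ne (Nat.le_ceil d) (hdn _)) hpd
  have hε0 : ε (⌈d⌉₊ + ⌈b⌉₊ + 1) ≠ 0 := by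
    rcases hε (⌈d⌉₊ + ⌈b⌉₊ + 1) with h | h <;> simp [h]
  obtain ⟨x, s, hx, hs, hx0, hs0, hdet⟩ := hchain.exists_det_neg hderiv hε0
  refine ⟨⌈d⌉₊ + ⌈b⌉₊ + 1, by omega, by omega, x, fun j => (s j)⁻¹, hx, ?_, hx0,
    fun j => inv_pos.2 (hs0 j), ?_⟩
  · exact fun i j hij => inv_strictAnti₀ (hs0 j) (hs hij)
  · have hmat : (Matrix.of fun i j => kernelT b d (x i) (s j)⁻¹) =
        Matrix.of fun i j => g 0 (x i * s j) := by
      ext i j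
      rw [Matrix.of_apply, Matrix.of_apply, hg0,
        tricomiH_eq_tricomiK d hb (mul_pos (hx0 i) (hs0 j)), kernelT, tricomiK, div_inv_eq_mul]
    rwa [hmat]
end

section
/- (Laplace transform identity of Koudou–Vallois/Letac for Kummer distributions of type 2.) Let a, b, c, λ > 0 and set I₁(s) = ∫₀^∞ e^{−sx} x^{a+b−1} (1+x)^{−a} dx and I₂(s) = ∫₀^∞ e^{−sx} x^{a−1} (1+x)^{−(a+b)} dx for s > 0. Then I₁(c+λ)·I₂(c)·(c+λ)^b = I₂(c+λ)·I₁(c)·c^b; equivalently, Ψ(a+b, 1+b, c+λ)/Ψ(a+b, 1+b, c) = (Ψ(a, 1−b, c+λ)/Ψ(a, 1−b, c))·(c/(c+λ))^b. This expresses that the Kummer random variable K²(a+b,−b,c) has the same distribution as the independent sum K²(a,b,c) + c^{−1}γ(b). -/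
open MeasureTheory Set in
theorem integrableOn_rpow_mul_exp_neg_mul_Ioi {p r : ℝ} (hp : 0 < p) (hr : 0 < r) :
    IntegrableOn (fun t : ℝ => t ^ (p - 1) * Real.exp (-(r * t))) (Ioi 0) := by
  refine Integrable.of_integral_ne_zero ?_
  rw [Real.integral_rpow_mul_exp_neg_mul_Ioi hp hr]
  have := Real.Gamma_pos_of_pos hp
  positivity

open MeasureTheory Set in
/-- Kummer's transformation `Ψ(a, 1 - b, s) = s ^ b Ψ(a + b, 1 + b, s)` of the Tricomi function, in
terms of the Laplace integrals. -/
theorem Gamma_mul_rpow_mul_integral_eq (a b s : ℝ) (ha : 0 < a) (hb : 0 < b) (hs : 0 < s) :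
    Real.Gamma a * s ^ b *
      (∫ x in Ioi (0:ℝ), Real.exp (-s * x) * x ^ (a + b - 1) * (1 + x) ^ (-a)) =
    Real.Gamma (a + b) *
      (∫ x in Ioi (0:ℝ), Real.exp (-s * x) * x ^ (a - 1) * (1 + x) ^ (-(a + b))) := by
  have hab : 0 < a + b := add_pos ha hb
  let f : ℝ → ℝ → ℝ := fun x t =>
    Real.exp (-s * x) * x ^ (a + b - 1) * (t ^ (a - 1) * Real.exp (-((1 + x) * t)))
  have inner_t : ∀ x ∈ Ioi (0:ℝ), ∫ t in Ioi (0:ℝ), f x t =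
      Real.Gamma a * (Real.exp (-s * x) * x ^ (a + b - 1) * (1 + x) ^ (-a)) := by
    intro x hx
    have hx1 : (0:ℝ) < 1 + x := add_pos one_pos hx
    simp only [f]
    rw [integral_const_mul, Real.integral_rpow_mul_exp_neg_mul_Ioi ha hx1, one_div,
      Real.inv_rpow hx1.le, Real.rpow_neg hx1.le]
    ring
  have inner_x : ∀ t ∈ Ioi (0:ℝ), ∫ x in Ioi (0:ℝ), f x t =
      Real.Gamma (a + b) * (Real.exp (-t) * t ^ (a - 1) * (s + t) ^ (-(a + b))) := by
    intro t ht
    have ht1 : (0:ℝ) < s + t := add_pos hs ht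
    have : ∀ x, f x t = Real.exp (-t) * t ^ (a - 1) *
        (x ^ (a + b - 1) * Real.exp (-((s + t) * x))) := by
      intro x
      have : Real.exp (-s * x) * Real.exp (-((1 + x) * t)) =
          Real.exp (-t) * Real.exp (-((s + t) * x)) := by
        rw [← Real.exp_add, ← Real.exp_add]; ring_nf
      simp only [f]
      linear_combination x ^ (a + b - 1) * t ^ (a - 1) * this
    simp only [this]
    rw [integral_const_mul, Real.integral_rpow_mul_exp_neg_mul_Ioi hab ht1, one_div,
      Real.inv_rpow ht1.le, Real.rpow_neg ht1.le]
    ring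
  have f_nonneg : ∀ x ∈ Ioi (0:ℝ), ∀ t ∈ Ioi (0:ℝ), 0 ≤ f x t := by
    intro x hx t ht
    have hx : 0 < x := hx
    have ht : 0 < t := ht
    positivity
  have f_int : Integrable (Function.uncurry f)
      ((volume.restrict (Ioi (0:ℝ))).prod (volume.restrict (Ioi (0:ℝ)))) := by
    have meas : Measurable (Function.uncurry f) := by
      simp only [f, Function.uncurry_def]; fun_prop
    rw [integrable_prod_iff meas.aestronglyMeasurable]
    constructor
    · filter_upwards [ae_restrict_mem measurableSet_Ioi] with x hx
      exact (integrableOn_rpow_mul_exp_neg_mul_Ioi ha (add_pos one_pos hx)).const_mul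
        (Real.exp (-s * x) * x ^ (a + b - 1))
    · have norm_eq : ∀ x ∈ Ioi (0:ℝ), ∫ t in Ioi (0:ℝ), ‖f x t‖ =
          Real.Gamma a * (Real.exp (-s * x) * x ^ (a + b - 1) * (1 + x) ^ (-a)) := by
        intro x hx
        rw [← inner_t x hx]
        exact setIntegral_congr_fun measurableSet_Ioi
          fun t ht => Real.norm_of_nonneg (f_nonneg x hx t ht)
      refine IntegrableOn.congr_fun (Integrable.const_mul ?_ _)
        (fun x hx => (norm_eq x hx).symm) measurableSet_Ioi
      refine (integrableOn_rpow_mul_exp_neg_mul_Ioi hab hs).mono'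
        (Measurable.aestronglyMeasurable (by fun_prop)) ?_
      filter_upwards [ae_restrict_mem measurableSet_Ioi] with x hx
      have hx : 0 < x := hx
      rw [Real.norm_of_nonneg (by positivity), mul_comm (x ^ _), ← neg_mul]
      exact mul_le_of_le_one_right (by positivity)
        (Real.rpow_le_one_of_one_le_of_nonpos (by linarith) (by linarith))
  have swap := integral_integral_swap f_int
  rw [setIntegral_congr_fun measurableSet_Ioi inner_t,
    setIntegral_congr_fun measurableSet_Ioi inner_x, integral_const_mul, integral_const_mul] at swap
  have scale := integral_comp_mul_left_Ioi
    (fun t : ℝ => Real.exp (-t) * t ^ (a - 1) * (s + t) ^ (-(a + b))) 0 hs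
  have pull : ∀ x ∈ Ioi (0:ℝ),
      Real.exp (-(s * x)) * (s * x) ^ (a - 1) * (s + s * x) ^ (-(a + b)) =
      (s⁻¹ * (s ^ b)⁻¹) * (Real.exp (-s * x) * x ^ (a - 1) * (1 + x) ^ (-(a + b))) := by
    intro x hx
    have hx : 0 < x := hx
    have pow : s ^ (a - 1) * s ^ (-(a + b)) = s⁻¹ * (s ^ b)⁻¹ := by
      rw [← Real.rpow_add hs, ← Real.rpow_neg hs.le, ← Real.rpow_neg_one, ← Real.rpow_add hs]
      ring_nf
    rw [show s + s * x = s * (1 + x) by ring, Real.mul_rpow hs.le hx.le,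
      Real.mul_rpow hs.le (by positivity), ← pow, neg_mul]
    ring
  rw [setIntegral_congr_fun measurableSet_Ioi pull, integral_const_mul, mul_zero,
    smul_eq_mul, mul_assoc] at scale
  have scale := mul_left_cancel₀ (inv_ne_zero hs.ne') scale
  rw [← scale] at swap
  have hsb : s ^ b ≠ 0 := (Real.rpow_pos_of_pos hs b).ne'
  rw [mul_right_comm, swap]
  field_simp

/-- Laplace transform identity of Koudou–Vallois/Letac for Kummer distributions of
type 2: with `I₁(s) = ∫₀^∞ e^{-sx} x^{a+b-1}(1+x)^{-a} dx` and
`I₂(s) = ∫₀^∞ e^{-sx} x^{a-1}(1+x)^{-(a+b)} dx`, one has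
`I₁(c+λ) I₂(c) (c+λ)^b = I₂(c+λ) I₁(c) c^b`. -/
theorem kummer_laplace_identity (a b c lam : ℝ)
    (ha : 0 < a) (hb : 0 < b) (hc : 0 < c) (hlam : 0 < lam) :
    (∫ x in Set.Ioi (0:ℝ), Real.exp (-(c + lam) * x) * x ^ (a + b - 1) * (1 + x) ^ (-a)) *
      (∫ x in Set.Ioi (0:ℝ), Real.exp (-c * x) * x ^ (a - 1) * (1 + x) ^ (-(a + b))) *
      (c + lam) ^ b
    = (∫ x in Set.Ioi (0:ℝ), Real.exp (-(c + lam) * x) * x ^ (a - 1) * (1 + x) ^ (-(a + b))) *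
      (∫ x in Set.Ioi (0:ℝ), Real.exp (-c * x) * x ^ (a + b - 1) * (1 + x) ^ (-a)) *
      c ^ b := by
  have h₁ := Gamma_mul_rpow_mul_integral_eq a b (c + lam) ha hb (add_pos hc hlam)
  have h₂ := Gamma_mul_rpow_mul_integral_eq a b c ha hb hc
  have hΓ : Real.Gamma a * Real.Gamma (a + b) ≠ 0 :=
    (mul_pos (Real.Gamma_pos_of_pos ha) (Real.Gamma_pos_of_pos (add_pos ha hb))).ne'
  apply mul_left_cancel₀ hΓ
  linear_combination Real.Gamma (a + b) *
    (∫ x in Set.Ioi (0:ℝ), Real.exp (-c * x) * x ^ (a - 1) * (1 + x) ^ (-(a + b))) * h₁ -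
    Real.Gamma (a + b) *
    (∫ x in Set.Ioi (0:ℝ), Real.exp (-(c + lam) * x) * x ^ (a - 1) * (1 + x) ^ (-(a + b))) * h₂
end

section
/- (Sylvester recursion for the weighted Hankel determinants.) For every integer n ≥ 2, all reals b > 0, d ∈ ℝ and z > 0, one has D^{n−2}_{b,d}(z) · D^n_{b,d}(z) = d · D^{n−1}_{b,d−1}(z) · D^{n−1}_{b,d+1}(z) + (n−d) · (D^{n−1}_{b,d}(z))². -/
/-- The weighted Hankel determinant
`D^n_{b,d}(z) = det[(d-n+j)_i f_{b,d-n+i+j}(z)]_{0 ≤ i,j ≤ n}`. -/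
noncomputable def hankelD (n : ℕ) (b d z : ℝ) : ℝ :=
  Matrix.det (Matrix.of fun i j : Fin (n+1) =>
    (ascPochhammer ℝ (i : ℕ)).eval (d - (n : ℝ) + (j : ℕ)) *
      tricomiF b (d - (n : ℝ) + (i : ℕ) + (j : ℕ)) z)

open Matrix in
/-- A `2 × 2` minor of the adjugate of a matrix over a domain with nonzero determinant. -/
theorem Matrix.adjugate_minor_of_det_ne_zero {n : ℕ} {R : Type*} [CommRing R] [IsDomain R]
    (M : Matrix (Fin (n + 2)) (Fin (n + 2)) R) (hM : M.det ≠ 0) :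
    M.adjugate 0 0 * M.adjugate (Fin.last _) (Fin.last _)
        - M.adjugate 0 (Fin.last _) * M.adjugate (Fin.last _) 0 =
      M.det * (M.submatrix (fun i : Fin n => i.succ.castSucc) fun j => j.succ.castSucc).det := by
  have h0l : (0 : Fin (n + 2)) ≠ Fin.last (n + 1) := (Fin.last_pos).ne
  set B : Matrix (Fin (n + 2)) (Fin (n + 2)) R :=
    ((1 : Matrix _ _ R).updateCol 0 (M.adjugate.col 0)).updateCol (Fin.last _)
      (M.adjugate.col (Fin.last _)) with hB
  have hdetB : B.det = M.adjugate 0 0 * M.adjugate (Fin.last _) (Fin.last _)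
      - M.adjugate 0 (Fin.last _) * M.adjugate (Fin.last _) 0 := by
    let e : Fin 2 → Fin (n + 2) := ![0, Fin.last _]
    have hB' : B = 1 + (M.adjugate - 1).submatrix id e *
        (1 : Matrix (Fin (n + 2)) (Fin (n + 2)) R).submatrix e id := by
      ext i j
      simp only [hB, add_apply, mul_apply, submatrix_apply, Fin.sum_univ_two, e, id, sub_apply,
        updateCol_apply, col_apply, cons_val_zero, cons_val_one]
      rcases eq_or_ne j (Fin.last _) with rfl | h1
      · simp [h0l, one_apply]
      · rcases eq_or_ne j 0 with rfl | h2
        · by_cases hi : i = 0 <;> simp [h0l, h0l.symm, one_apply, hi]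
        · simp [h1, h2, h1.symm, h2.symm, one_apply]
    rw [hB', det_one_add_mul_comm, det_fin_two]
    have : (1 : Matrix (Fin (n + 2)) (Fin (n + 2)) R).submatrix e id *
        (M.adjugate - 1).submatrix id e = (M.adjugate - 1).submatrix e e := by
      rw [← submatrix_mul _ _ e id e Function.bijective_id, one_mul]
    simp only [this, add_apply, submatrix_apply, sub_apply, e, cons_val_zero, cons_val_one]
    simp [h0l, h0l.symm]
  have hcol (j : Fin (n + 2)) : M *ᵥ M.adjugate.col j = M.det • Pi.single j 1 := by
    rw [← mulVec_single_one, mulVec_mulVec, mul_adjugate, smul_mulVec, one_mulVec]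
  have hdet : ((M.updateCol (Fin.last _) (Pi.single (Fin.last _) 1)).updateCol 0
      (Pi.single 0 1)).det =
      (M.submatrix (fun i : Fin n => i.succ.castSucc) fun j => j.succ.castSucc).det := by
    rw [det_succ_column_zero, Fintype.sum_eq_single 0 (fun i hi => by simp [hi])]
    simp only [updateCol_self, Pi.single_eq_same, Fin.val_zero, pow_zero, one_mul]
    rw [det_succ_column _ (Fin.last n), Fintype.sum_eq_single (Fin.last n)
      (fun i hi => by
        have : i.succ ≠ Fin.last (n + 1) := by
          rwa [← Fin.succ_last, Ne, Fin.succ_inj]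
        simp [this])]
    have : (-1 : R) ^ (n + n) = 1 := Even.neg_one_pow ⟨n, rfl⟩
    simp only [submatrix_apply, Fin.val_last, this, Fin.succAbove_zero, Fin.succ_last,
      updateCol_apply, h0l.symm, Fin.succAbove_last, Pi.single_eq_same, if_true, if_false,
      mul_one, one_mul, submatrix_submatrix]
    congr 1
    ext i j
    simp [Fin.succ_ne_zero]
  have hmul : (M * B).det = M.det * (M.det *
      (M.submatrix (fun i : Fin n => i.succ.castSucc) fun j => j.succ.castSucc).det) := by
    rw [hB, mul_updateCol, mul_updateCol, mul_one, hcol, hcol, det_updateCol_smul,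
      updateCol_comm _ h0l, det_updateCol_smul, hdet]
  rw [← hdetB]
  apply mul_left_cancel₀ hM
  rw [← det_mul, hmul]

open Matrix in
/-- The **Desnanot–Jacobi identity**. -/
theorem Matrix.det_mul_det_submatrix_interior {n : ℕ} {R : Type*} [CommRing R]
    (M : Matrix (Fin (n + 2)) (Fin (n + 2)) R) :
    M.det * (M.submatrix (fun i : Fin n => i.succ.castSucc) fun j => j.succ.castSucc).det =
      (M.submatrix Fin.succ Fin.succ).det * (M.submatrix Fin.castSucc Fin.castSucc).det
        - (M.submatrix Fin.castSucc Fin.succ).det * (M.submatrix Fin.succ Fin.castSucc).det := by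
  have key := adjugate_minor_of_det_ne_zero (mvPolynomialX (Fin (n + 2)) (Fin (n + 2)) ℤ)
    (det_mvPolynomialX_ne_zero _ _)
  have hsign (k : ℕ) : (-1 : MvPolynomial (Fin (n + 2) × Fin (n + 2)) ℤ) ^ k * (-1) ^ k = 1 := by
    rw [← mul_pow]; simp
  simp only [adjugate_fin_succ_eq_det_submatrix, Fin.succAbove_zero, Fin.succAbove_last,
    Fin.val_zero, Fin.val_last, add_zero, zero_add, pow_zero, one_mul] at key
  rw [pow_add, hsign, one_mul, mul_mul_mul_comm, hsign, one_mul] at key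
  have := congrArg (MvPolynomial.aeval fun p : Fin (n + 2) × Fin (n + 2) => M p.1 p.2) key
  simp only [map_sub, map_mul, AlgHom.map_det, AlgHom.mapMatrix_apply, ← submatrix_map] at this
  simp only [← AlgHom.mapMatrix_apply, mvPolynomialX_mapMatrix_aeval] at this
  exact this.symm

/-- The determinant of `((a + s + j)_i F (s + i + j))` for `0 ≤ i, j < m`. -/
noncomputable def pochhammerHankel {R : Type*} [CommRing R] (F : ℕ → R) (a : R) (m s : ℕ) : R :=
  Matrix.det (Matrix.of fun i j : Fin m =>
    (ascPochhammer R (i : ℕ)).eval (a + (s : R) + (j : ℕ)) * F (s + i + j))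

theorem ascPochhammer_eval_mul_eval_add {R : Type*} [CommRing R] (a : R) (k i : ℕ) :
    (ascPochhammer R k).eval a * (ascPochhammer R i).eval (a + k) =
      (ascPochhammer R (k + i)).eval a := by
  rw [← ascPochhammer_mul]
  simp

/-- Clearing denominators turns `pochhammerHankel` into an ordinary Hankel determinant. -/
theorem prod_mul_pochhammerHankel {R : Type*} [CommRing R] (F : ℕ → R) (a : R) (m s : ℕ) :
    (∏ j ∈ Finset.range m, (ascPochhammer R (s + j)).eval a) * pochhammerHankel F a m s =
      Matrix.det (Matrix.of fun i j : Fin m =>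
        (ascPochhammer R (s + i + j)).eval a * F (s + i + j)) := by
  rw [pochhammerHankel, ← Fin.prod_univ_eq_prod_range, ← Matrix.det_mul_row]
  congr 1
  ext i j
  simp only [Matrix.of_apply]
  rw [← mul_assoc, add_assoc a, ← Nat.cast_add, ascPochhammer_eval_mul_eval_add,
    add_right_comm s (i : ℕ)]

theorem hankel_det_mul_det {R : Type*} [CommRing R] (g : ℕ → R) (m : ℕ) :
    Matrix.det (Matrix.of fun i j : Fin (m + 3) => g (0 + i + j)) *
        Matrix.det (Matrix.of fun i j : Fin (m + 1) => g (2 + i + j)) =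
      Matrix.det (Matrix.of fun i j : Fin (m + 2) => g (2 + i + j)) *
        Matrix.det (Matrix.of fun i j : Fin (m + 2) => g (0 + i + j)) -
        Matrix.det (Matrix.of fun i j : Fin (m + 2) => g (1 + i + j)) ^ 2 := by
  have h := Matrix.det_mul_det_submatrix_interior
    (Matrix.of fun i j : Fin (m + 3) => g (0 + i + j))
  rw [sq]
  convert h using 4 <;> (try congr 1) <;> ext i j <;>
    simp only [Matrix.of_apply, Fin.val_succ, Fin.val_castSucc] <;>
    congr 1 <;> ring

theorem pochhammerHankel_recursion_of_ne_zero {R : Type*} [CommRing R] [IsDomain R]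
    (F : ℕ → R) (a : R) (ha : ∀ k, (ascPochhammer R k).eval a ≠ 0) (m : ℕ) :
    pochhammerHankel F a (m + 1) 2 * pochhammerHankel F a (m + 3) 0 =
      (a + (m + 2)) * pochhammerHankel F a (m + 2) 0 * pochhammerHankel F a (m + 2) 2
        - a * pochhammerHankel F a (m + 2) 1 ^ 2 := by
  have h := hankel_det_mul_det (fun k => (ascPochhammer R k).eval a * F k) m
  simp only [← prod_mul_pochhammerHankel] at h
  set w : ℕ → R := fun k => (ascPochhammer R k).eval a with hw
  set c := ∏ j ∈ Finset.range m, w (2 + j) with hc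
  have hc0 : c ≠ 0 := Finset.prod_ne_zero_iff.2 fun j _ => ha _
  have hw0 : w 0 = 1 := by simp [hw]
  have hw1 : w 1 = a := by simp [hw]
  have hw3 : w (2 + (m + 1)) = w (2 + m) * (a + (m + 2)) := by
    simp only [hw]
    rw [← add_assoc, ascPochhammer_succ_eval]
    push_cast
    ring
  have h21 : ∏ j ∈ Finset.range (m + 1), w (2 + j) = c * w (2 + m) := Finset.prod_range_succ _ _
  have h22 : ∏ j ∈ Finset.range (m + 2), w (2 + j) = c * w (2 + m) * w (2 + (m + 1)) := by
    rw [Finset.prod_range_succ, h21]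
  have h1 : ∏ j ∈ Finset.range (m + 2), w (1 + j) = a * (c * w (2 + m)) := by
    rw [Finset.prod_range_succ', ← h21, add_zero, hw1, mul_comm]
    congr 1
    exact Finset.prod_congr rfl fun j _ => by congr 1; ring
  have h02 : ∏ j ∈ Finset.range (m + 2), w (0 + j) = a * c := by
    rw [Finset.prod_range_succ', Finset.prod_range_succ', add_zero, hw0, hc, mul_one, zero_add,
      zero_add, hw1, mul_comm]
    congr 1
    exact Finset.prod_congr rfl fun j _ => by congr 1; ring
  have h03 : ∏ j ∈ Finset.range (m + 3), w (0 + j) = a * c * w (2 + m) := by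
    rw [Finset.prod_range_succ, h02]
    congr 2
    ring
  change (∏ j ∈ Finset.range (m + 3), w (0 + j)) * _ *
    ((∏ j ∈ Finset.range (m + 1), w (2 + j)) * _) =
    (∏ j ∈ Finset.range (m + 2), w (2 + j)) * _ * ((∏ j ∈ Finset.range (m + 2), w (0 + j)) * _) -
    ((∏ j ∈ Finset.range (m + 2), w (1 + j)) * _) ^ 2 at h
  rw [h21, h22, h1, h02, h03, hw3] at h
  have ha0 : a ≠ 0 := hw1 ▸ ha 1
  have hne : a * c ^ 2 * w (2 + m) ^ 2 ≠ 0 :=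
    mul_ne_zero (mul_ne_zero ha0 (pow_ne_zero _ hc0)) (pow_ne_zero _ (ha _))
  apply mul_left_cancel₀ hne
  linear_combination h

open Polynomial in
theorem pochhammerHankel_recursion {R : Type*} [CommRing R] [IsDomain R]
    (F : ℕ → R) (a : R) (m : ℕ) :
    pochhammerHankel F a (m + 1) 2 * pochhammerHankel F a (m + 3) 0 =
      (a + (m + 2)) * pochhammerHankel F a (m + 2) 0 * pochhammerHankel F a (m + 2) 2
        - a * pochhammerHankel F a (m + 2) 1 ^ 2 := by
  have hX (k : ℕ) : (ascPochhammer R[X] k).eval X = ascPochhammer R k := by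
    rw [← ascPochhammer_map (C : R →+* R[X]), eval_map, eval₂_C_X]
  have h := pochhammerHankel_recursion_of_ne_zero (fun k => C (F k)) X
    (fun k => by rw [hX]; exact (monic_ascPochhammer R k).ne_zero) m
  have heval (x : R[X]) (k : ℕ) : eval a ((ascPochhammer R[X] k).eval x) =
      (ascPochhammer R k).eval (eval a x) := by
    rw [← ascPochhammer_map (evalRingHom a) k, eval_map, ← coe_evalRingHom, eval₂_at_apply]
  have hev (l s : ℕ) : eval a (pochhammerHankel (fun k => C (F k)) X l s) =
      pochhammerHankel F a l s := by
    rw [pochhammerHankel, ← coe_evalRingHom, RingHom.map_det, pochhammerHankel]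
    congr 1
    ext i j
    simp only [RingHom.mapMatrix_apply, Matrix.map_apply, Matrix.of_apply, coe_evalRingHom,
      eval_mul, eval_C]
    rw [heval]
    simp
  have := congrArg (eval a) h
  simpa only [eval_mul, eval_sub, eval_add, eval_pow, eval_X, eval_natCast, eval_ofNat, hev]
    using this

theorem hankelD_eq_pochhammerHankel (n s N : ℕ) (b d d' z : ℝ) (h : d' - n = d - N + s) :
    hankelD n b d' z = pochhammerHankel (fun k => tricomiF b (d - N + k) z) (d - N) (n + 1) s := by
  simp only [hankelD, pochhammerHankel, h, Nat.cast_add, add_assoc]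

/-- Sylvester recursion for the weighted Hankel determinants:
`D^{n-2}_{b,d} D^n_{b,d} = d D^{n-1}_{b,d-1} D^{n-1}_{b,d+1} + (n-d) (D^{n-1}_{b,d})²`. -/
theorem hankelD_sylvester (n : ℕ) (hn : 2 ≤ n) (b d z : ℝ) (hb : 0 < b) (hz : 0 < z) :
    hankelD (n - 2) b d z * hankelD n b d z
      = d * hankelD (n - 1) b (d - 1) z * hankelD (n - 1) b (d + 1) z
        + ((n : ℝ) - d) * (hankelD (n - 1) b d z) ^ 2 := by
  obtain ⟨m, rfl⟩ := Nat.exists_eq_add_of_le' hn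
  have e2 : m + 2 - 2 = m := by omega
  have e1 : m + 2 - 1 = m + 1 := by omega
  rw [e2, e1, hankelD_eq_pochhammerHankel m 2 (m + 2) b d d z (by push_cast; ring),
    hankelD_eq_pochhammerHankel (m + 2) 0 (m + 2) b d d z (by push_cast; ring),
    hankelD_eq_pochhammerHankel (m + 1) 0 (m + 2) b d (d - 1) z (by push_cast; ring),
    hankelD_eq_pochhammerHankel (m + 1) 2 (m + 2) b d (d + 1) z (by push_cast; ring),
    hankelD_eq_pochhammerHankel (m + 1) 1 (m + 2) b d d z (by push_cast; ring),
    pochhammerHankel_recursion]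
  push_cast
  ring
end

section
/- Let n ≥ 1 be an integer and b, d real numbers such that there exists k ∈ {1,…,n} with k−1 < d < k and n−k < b < n−k+1 (i.e. (d,b) belongs to the upper staircase region E_n^+). Then D^n_{b,d}(z) > 0 for every z > 0. -/
open MeasureTheory Set

/-- The `N × N` Hankel matrix of a sequence. -/
def hankelMatrix (ν : ℕ → ℝ) (N : ℕ) : Matrix (Fin N) (Fin N) ℝ :=
  Matrix.of fun i j => ν (i + j)

/-- Coefficients of the `j`-th (unnormalised) orthogonal polynomial of a moment sequence. -/
theorem exists_hankel_orthogonal (ν : ℕ → ℝ) (j : ℕ) :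
    ∃ v : ℕ → ℝ, (∀ i, j < i → v i = 0) ∧ v j = (hankelMatrix ν j).det ∧
      ∀ N, j < N → ∀ i ≤ j, ∑ l : Fin N, ν (i + l) * v l =
        if i = j then (hankelMatrix ν (j + 1)).det else 0 := by
  refine ⟨fun i => if h : i < j + 1 then
    (hankelMatrix ν (j + 1)).adjugate ⟨i, h⟩ (Fin.last j) else 0, ?_, ?_, ?_⟩
  · intro i hi
    simp only [dif_neg (show ¬ i < j + 1 by omega)]
  · simp only [lt_add_iff_pos_right, zero_lt_one, dite_true]
    have : (⟨j, by omega⟩ : Fin (j + 1)) = Fin.last j := rfl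
    rw [this, Matrix.adjugate_fin_succ_eq_det_submatrix, ← two_mul, pow_mul]
    simp only [even_two, Even.neg_pow, one_pow, one_mul]
    congr 1
    ext a b
    simp [hankelMatrix]
  · intro N hN i hi
    have h1 := congrFun (congrFun (Matrix.mul_adjugate (hankelMatrix ν (j + 1)))
      ⟨i, by omega⟩) (Fin.last j)
    rw [Matrix.mul_apply] at h1
    rw [Fin.sum_univ_eq_sum_range (fun l => ν (i + l) * if h : l < j + 1 then
      (hankelMatrix ν (j + 1)).adjugate ⟨l, h⟩ (Fin.last j) else 0) N,
      ← Finset.sum_subset (Finset.range_subset_range.2 (show j + 1 ≤ N from hN)),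
      ← Fin.sum_univ_eq_sum_range]
    · simp only [Fin.is_lt, dite_true]
      refine Eq.trans h1 ?_
      simp [Matrix.one_apply, Fin.ext_iff]
    · intro x _ hx
      have : ¬ x < j + 1 := by simpa using hx
      simp [this]

/-- A block matrix with a negative diagonal upper left block and a positive definite lower right
block has determinant of sign `(-1) ^ r`. -/
theorem det_fromBlocks_neg_posDef {r s : ℕ} (δ : Fin r → ℝ) (hδ : ∀ q, δ q < 0)
    (B : Matrix (Fin r) (Fin s) ℝ) (C : Matrix (Fin s) (Fin s) ℝ) (hC : C.PosDef) :
    0 < (-1) ^ r * (Matrix.fromBlocks (Matrix.diagonal δ) B B.transpose C).det := by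
  have : Invertible C := hC.isUnit.invertible
  rw [Matrix.det_fromBlocks₂₂]
  have h : (Matrix.diagonal (fun q => -δ q) + B * C⁻¹ * B.transpose).PosDef := by
    refine (Matrix.PosDef.diagonal fun q => neg_pos.2 (hδ q)).add_posSemidef ?_
    simpa using hC.inv.posSemidef.mul_mul_conjTranspose_same B
  have e : Matrix.diagonal δ - B * ⅟C * B.transpose =
      -(Matrix.diagonal (fun q => -δ q) + B * C⁻¹ * B.transpose) := by
    have hd : Matrix.diagonal (fun q => -δ q) = -Matrix.diagonal δ := (Matrix.diagonal_neg δ).symm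
    rw [Matrix.invOf_eq_nonsing_inv, hd]
    abel
  rw [e, Matrix.det_neg, Fintype.card_fin]
  have hs : ((-1 : ℝ) ^ r) * (-1) ^ r = 1 := by rw [← mul_pow]; simp
  calc (0:ℝ) < C.det * (Matrix.diagonal (fun q => -δ q) + B * C⁻¹ * B.transpose).det :=
        mul_pos hC.det_pos h.det_pos
    _ = _ := by linear_combination -(C.det *
          (Matrix.diagonal (fun q => -δ q) + B * C⁻¹ * B.transpose).det) * hs

/-- If `r` pivots of a Hankel matrix of size `r + s` are negative while its lower right
`s × s` block is positive definite, then its determinant has sign `(-1) ^ r`. -/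
theorem hankelMatrix_det_sign (ν : ℕ → ℝ) (r s : ℕ) (js : Fin r → ℕ)
    (hinj : Function.Injective js) (hlt : ∀ q, js q < r + s)
    (hneg : ∀ q, (hankelMatrix ν (js q + 1)).det * (hankelMatrix ν (js q)).det < 0)
    (hpos : (hankelMatrix (fun l => ν (2 * r + l)) s).PosDef) :
    0 < (-1) ^ r * (hankelMatrix ν (r + s)).det := by
  choose V hV0 hVj hVs using exists_hankel_orthogonal ν
  set H := hankelMatrix ν (r + s) with hH
  have hsymm : H.transpose = H := by
    ext i j; simp [hH, hankelMatrix, add_comm]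
  set K₁ : Matrix (Fin (r + s)) (Fin r) ℝ := Matrix.of fun i q => V (js q) i with hK₁
  set K₂ : Matrix (Fin (r + s)) (Fin s) ℝ :=
    Matrix.of fun i p => if i = Fin.natAdd r p then 1 else 0 with hK₂
  have hHV : ∀ q (i : Fin (r + s)), (i : ℕ) ≤ js q →
      (H * K₁) i q = if (i : ℕ) = js q then (hankelMatrix ν (js q + 1)).det else 0 := by
    intro q i hi
    rw [Matrix.mul_apply]
    exact hVs (js q) (r + s) (hlt q) i hi
  have h11le : ∀ q q', js q ≤ js q' → (K₁.transpose * H * K₁) q q' =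
      if q = q' then (hankelMatrix ν (js q + 1)).det * (hankelMatrix ν (js q)).det else 0 := by
    intro q q' hqq
    rw [Matrix.mul_assoc, Matrix.mul_apply]
    rw [Finset.sum_eq_single (⟨js q', hlt q'⟩ : Fin (r + s))]
    · rw [hHV q' _ le_rfl]
      simp only [hK₁, Matrix.transpose_apply, Matrix.of_apply, if_true]
      split_ifs with h
      · subst h; rw [hVj]; ring
      · rw [hV0 _ _ (lt_of_le_of_ne hqq fun h' => h (hinj h')), zero_mul]
    · intro i _ hi
      rcases le_or_gt (i : ℕ) (js q') with h | h
      · rw [hHV q' i h, if_neg (fun h' => hi (Fin.ext h')), mul_zero]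
      · simp only [hK₁, Matrix.transpose_apply, Matrix.of_apply]
        rw [hV0 _ _ (by omega), zero_mul]
    · simp
  have h11 : K₁.transpose * H * K₁ = Matrix.diagonal fun q =>
      (hankelMatrix ν (js q + 1)).det * (hankelMatrix ν (js q)).det := by
    ext q q'
    rw [Matrix.diagonal_apply]
    rcases le_total (js q) (js q') with h | h
    · exact h11le q q' h
    · have h2 : (K₁.transpose * H * K₁).transpose = K₁.transpose * H * K₁ := by
        simp [Matrix.transpose_mul, hsymm, Matrix.mul_assoc]
      rw [← h2, Matrix.transpose_apply, h11le q' q h]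
      by_cases hq : q = q'
      · subst hq; rfl
      · simp [hq, Ne.symm hq]
  have h22 : K₂.transpose * H * K₂ = hankelMatrix (fun l => ν (2 * r + l)) s := by
    ext p p'
    simp only [Matrix.mul_apply, hK₂, Matrix.transpose_apply, Matrix.of_apply, ite_mul, one_mul,
      zero_mul, mul_ite, mul_one, mul_zero, Finset.sum_ite_eq', Finset.mem_univ, if_true]
    simp only [hH, hankelMatrix, Matrix.of_apply, Fin.val_natAdd]
    congr 1; ring
  set K : Matrix (Fin r ⊕ Fin s) (Fin r ⊕ Fin s) ℝ :=
    (Matrix.fromCols K₁ K₂).submatrix finSumFinEquiv id with hK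
  have hprod : K.transpose * H.submatrix finSumFinEquiv finSumFinEquiv * K =
      Matrix.fromBlocks (K₁.transpose * H * K₁) (K₁.transpose * H * K₂)
        (K₁.transpose * H * K₂).transpose (K₂.transpose * H * K₂) := by
    rw [hK, Matrix.transpose_submatrix, Matrix.submatrix_mul_equiv, Matrix.submatrix_mul_equiv,
      Matrix.submatrix_id_id, Matrix.transpose_fromCols, Matrix.fromRows_mul,
      Matrix.fromRows_mul_fromCols, Matrix.transpose_mul, Matrix.transpose_mul, hsymm,
      Matrix.transpose_transpose, Matrix.mul_assoc, Matrix.mul_assoc, Matrix.mul_assoc,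
      Matrix.mul_assoc]
  have hdet := det_fromBlocks_neg_posDef _ hneg (K₁.transpose * H * K₂) _ hpos
  rw [← h11, ← h22, ← hprod, Matrix.det_mul, Matrix.det_mul, Matrix.det_transpose,
    Matrix.det_submatrix_equiv_self] at hdet
  have : (-1 : ℝ) ^ r * (K.det * H.det * K.det) = ((-1) ^ r * H.det) * K.det ^ 2 := by ring
  rw [this] at hdet
  exact pos_of_mul_pos_left hdet (sq_nonneg _)

/-- `Γ(b)` times the Tricomi integral `tricomiF b ν z`. -/
noncomputable def tricomiIntegral (b ν z : ℝ) : ℝ :=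
  ∫ t in Ioi (0:ℝ), Real.exp (-t * z) * t ^ (b - 1) * (1 + t) ^ (-ν)

theorem exists_rpow_le_mul_exp (ν : ℝ) {ε : ℝ} (hε : 0 < ε) :
    ∃ C, 0 < C ∧ ∀ t : ℝ, 0 ≤ t → (1 + t) ^ (-ν) ≤ C * Real.exp (ε * t) := by
  obtain ⟨N, hN⟩ := exists_nat_ge (-ν)
  refine ⟨N.factorial / ε ^ N * Real.exp ε, by positivity, fun t ht => ?_⟩
  calc (1 + t) ^ (-ν) ≤ (1 + t) ^ (N : ℝ) :=
        Real.rpow_le_rpow_of_exponent_le (by linarith) hN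
    _ = N.factorial / ε ^ N * ((ε * (1 + t)) ^ N / N.factorial) := by
        rw [Real.rpow_natCast, mul_pow]; field_simp
    _ ≤ N.factorial / ε ^ N * Real.exp (ε * (1 + t)) := by
        gcongr
        exact Real.pow_div_factorial_le_exp _ (by positivity) N
    _ = _ := by rw [mul_assoc, ← Real.exp_add]; ring_nf

theorem exp_mul_rpow_mul_rpow_le (β ν : ℝ) {z : ℝ} (hz : 0 < z) :
    ∃ C, 0 < C ∧ ∀ t : ℝ, 0 < t → Real.exp (-t * z) * t ^ β * (1 + t) ^ (-ν) ≤
      C * (t ^ β * Real.exp (-(z / 2) * t)) := by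
  obtain ⟨C, hC, h⟩ := exists_rpow_le_mul_exp ν (half_pos hz)
  refine ⟨C, hC, fun t ht => ?_⟩
  calc Real.exp (-t * z) * t ^ β * (1 + t) ^ (-ν)
      ≤ Real.exp (-t * z) * t ^ β * (C * Real.exp (z / 2 * t)) := by
        gcongr; exact h t ht.le
    _ = C * (t ^ β * (Real.exp (-t * z) * Real.exp (z / 2 * t))) := by ring
    _ = _ := by rw [← Real.exp_add]; ring_nf

theorem integrableOn_tricomi {b : ℝ} (hb : 0 < b) (ν : ℝ) {z : ℝ} (hz : 0 < z) :
    IntegrableOn (fun t : ℝ => Real.exp (-t * z) * t ^ (b - 1) * (1 + t) ^ (-ν)) (Ioi 0) := by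
  obtain ⟨C, hC, h⟩ := exp_mul_rpow_mul_rpow_le (b - 1) ν hz
  have hi := integrableOn_rpow_mul_exp_neg_mul_rpow (s := b - 1) (p := 1) (b := z / 2)
    (by linarith) one_pos (half_pos hz)
  simp only [Real.rpow_one] at hi
  refine (hi.const_mul C).mono' ?_ ?_
  · exact (by fun_prop : Measurable fun t : ℝ =>
      Real.exp (-t * z) * t ^ (b - 1) * (1 + t) ^ (-ν)).aestronglyMeasurable
  · refine (ae_restrict_mem measurableSet_Ioi).mono fun t ht => ?_
    have ht : 0 < t := ht
    rw [Real.norm_of_nonneg (by positivity)]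
    exact h t ht

/-- The contiguity relation obtained by integrating by parts. -/
theorem mul_tricomiIntegral_add_one {b : ℝ} (hb : 1 < b) (ν : ℝ) {z : ℝ} (hz : 0 < z) :
    ν * tricomiIntegral b (ν + 1) z =
      (b - 1) * tricomiIntegral (b - 1) ν z - z * tricomiIntegral b ν z := by
  have i1 := integrableOn_tricomi (b := b) (by linarith) ν hz
  have i2 := integrableOn_tricomi (b := b - 1) (by linarith) ν hz
  have i3 := integrableOn_tricomi (b := b) (by linarith) (ν + 1) hz
  have key := integral_Ioi_of_hasDerivAt_of_tendsto (a := 0) (m := 0)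
    (f := fun t : ℝ => Real.exp (-t * z) * t ^ (b - 1) * (1 + t) ^ (-ν))
    (f' := fun t : ℝ => (b - 1) * (Real.exp (-t * z) * t ^ (b - 1 - 1) * (1 + t) ^ (-ν)) -
      z * (Real.exp (-t * z) * t ^ (b - 1) * (1 + t) ^ (-ν)) -
      ν * (Real.exp (-t * z) * t ^ (b - 1) * (1 + t) ^ (-(ν + 1)))) ?_ ?_ ?_ ?_
  · rw [integral_sub, integral_sub, integral_const_mul, integral_const_mul,
      integral_const_mul] at key
    · simp only [Real.zero_rpow (show b - 1 ≠ 0 by linarith)] at key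
      simp only [tricomiIntegral]
      linarith
    · exact i2.const_mul _
    · exact i1.const_mul _
    · exact (i2.const_mul _).sub (i1.const_mul _)
    · exact i3.const_mul _
  · have h1 : ContinuousAt (fun t : ℝ => t ^ (b - 1)) 0 :=
      Real.continuousAt_rpow_const _ _ (Or.inr (by linarith))
    have h2 : ContinuousAt (fun t : ℝ => (1 + t) ^ (-ν)) 0 :=
      ContinuousAt.rpow_const (by fun_prop) (Or.inl (by norm_num))
    have h3 : ContinuousAt (fun t : ℝ => Real.exp (-t * z)) 0 := by fun_prop
    exact ((h3.mul h1).mul h2).continuousWithinAt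
  · intro t ht
    have ht : 0 < t := ht
    have h1 : HasDerivAt (fun t : ℝ => t ^ (b - 1)) ((b - 1) * t ^ (b - 1 - 1)) t :=
      Real.hasDerivAt_rpow_const (Or.inl ht.ne')
    have h2 : HasDerivAt (fun t : ℝ => (1 + t) ^ (-ν)) (1 * (-ν) * (1 + t) ^ (-ν - 1)) t :=
      ((hasDerivAt_id t).const_add 1).rpow_const (Or.inl (by simp; positivity))
    have h3 : HasDerivAt (fun t : ℝ => Real.exp (-t * z)) (Real.exp (-t * z) * (-1 * z)) t :=
      ((hasDerivAt_neg t).mul_const z).exp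
    refine ((h3.mul h1).mul h2).congr_deriv ?_
    rw [show -(ν + 1) = -ν - 1 by ring]
    simp only [Pi.mul_apply]
    ring
  · exact ((i2.const_mul _).sub (i1.const_mul _)).sub (i3.const_mul _)
  · obtain ⟨C, hC, h⟩ := exp_mul_rpow_mul_rpow_le (b - 1) ν hz
    have h0 := (tendsto_rpow_mul_exp_neg_mul_atTop_nhds_zero (b - 1) (z / 2)
      (half_pos hz)).const_mul C
    rw [mul_zero] at h0
    refine squeeze_zero' ?_ ?_ h0
    · filter_upwards [Filter.eventually_gt_atTop 0] with t ht
      positivity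
    · filter_upwards [Filter.eventually_gt_atTop 0] with t ht
      exact h t ht

/-- Iterating integration by parts; the coefficients do not depend on `ν`. -/
theorem exists_ascPochhammer_mul_tricomiIntegral {z : ℝ} (hz : 0 < z) (i : ℕ) :
    ∀ b : ℝ, (i : ℝ) < b → ∃ τ : ℕ → ℝ, 0 < τ i ∧ (∀ l, i < l → τ l = 0) ∧
      ∀ ν, (ascPochhammer ℝ i).eval ν * tricomiIntegral b (ν + i) z =
        ∑ l ∈ Finset.range (i + 1), τ l * tricomiIntegral (b - l) ν z := by
  induction i with
  | zero =>
    intro b hb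
    refine ⟨fun l => if l = 0 then 1 else 0, by simp, fun l hl => by simp [hl.ne'], ?_⟩
    intro ν
    simp
  | succ i ih =>
    intro b hb
    push_cast at hb
    obtain ⟨τ, h1, h2, h3⟩ := ih b (by linarith)
    obtain ⟨σ, g1, g2, g3⟩ := ih (b - 1) (by linarith)
    have hb1 : 0 < b - 1 := by have : (0:ℝ) ≤ i := i.cast_nonneg; linarith
    refine ⟨fun l => (b - 1) * (if l = 0 then 0 else σ (l - 1)) - z * τ l, ?_, ?_, ?_⟩
    · simp only [Nat.add_one_ne_zero, if_false, Nat.add_sub_cancel, h2 (i + 1) (Nat.lt_succ_self i)]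
      nlinarith [mul_pos hb1 g1]
    · intro l hl
      simp [h2 l (by omega), g2 (l - 1) (by omega), show l ≠ 0 by omega]
    · intro ν
      have e := mul_tricomiIntegral_add_one (b := b) (by linarith) (ν + i) hz
      rw [ascPochhammer_succ_eval]
      push_cast
      rw [← add_assoc, mul_assoc, e, mul_sub, mul_left_comm, g3 ν,
        mul_left_comm ((ascPochhammer ℝ i).eval ν) z, h3 ν]
      rw [Finset.sum_congr rfl fun l _ => sub_mul ((b - 1) * if l = 0 then 0 else σ (l - 1))
        (z * τ l) (tricomiIntegral (b - l) ν z), Finset.sum_sub_distrib]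
      congr 1
      · rw [Finset.sum_range_succ' _ (i + 1), Finset.mul_sum]
        simp only [Nat.add_one_ne_zero, if_false, Nat.add_sub_cancel, if_true, mul_zero, zero_mul,
          add_zero, mul_assoc]
        refine Finset.sum_congr rfl fun l _ => ?_
        push_cast
        rw [show b - 1 - (l : ℝ) = b - (l + 1) by ring]
      · rw [Finset.sum_range_succ _ (i + 1), h2 (i + 1) (Nat.lt_succ_self i), Finset.mul_sum]
        simp only [mul_zero, zero_mul, add_zero, mul_assoc]

/-- Gram matrices of distinct monomials for a positive weight are positive definite. -/
theorem posDef_gram_monomials (ω : ℝ → ℝ) (hω : ∀ t, 0 < t → 0 < ω t)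
    (hi : ∀ k : ℕ, IntegrableOn (fun t => ω t * t ^ k) (Ioi 0)) {N : ℕ}
    (e : Fin N → ℕ) (he : Function.Injective e) :
    (Matrix.of fun i j : Fin N => ∫ t in Ioi (0:ℝ), ω t * t ^ (e i + e j)).PosDef := by
  refine Matrix.PosDef.of_dotProduct_mulVec_pos ?_ fun x hx => ?_
  · ext i j; simp [add_comm]
  set P : Polynomial ℝ := ∑ i, Polynomial.C (x i) * Polynomial.X ^ e i with hP
  have hPne : P ≠ 0 := by
    obtain ⟨i, hxi⟩ := Function.ne_iff.1 hx
    intro h0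
    apply hxi
    have : P.coeff (e i) = x i := by
      simp [hP, Polynomial.coeff_X_pow, he.eq_iff]
    rw [← this, h0]; rfl
  have hev : ∀ t, ω t * (P.eval t) ^ 2 =
      ∑ i, ∑ j, x i * (x j * (ω t * t ^ (e i + e j))) := by
    intro t
    simp only [hP, Polynomial.eval_finsetSum, Polynomial.eval_mul, Polynomial.eval_C,
      Polynomial.eval_pow, Polynomial.eval_X]
    rw [sq, Finset.sum_mul_sum, Finset.mul_sum]
    refine Finset.sum_congr rfl fun i _ => ?_
    rw [Finset.mul_sum]
    refine Finset.sum_congr rfl fun j _ => ?_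
    ring
  have hint : IntegrableOn (fun t => ω t * (P.eval t) ^ 2) (Ioi 0) := by
    simp only [hev]
    exact integrable_finsetSum _ fun i _ => integrable_finsetSum _ fun j _ =>
      ((hi _).const_mul _).const_mul _
  have hval : star x ⬝ᵥ (Matrix.of fun i j : Fin N =>
      ∫ t in Ioi (0:ℝ), ω t * t ^ (e i + e j)).mulVec x =
      ∫ t in Ioi (0:ℝ), ω t * (P.eval t) ^ 2 := by
    simp only [hev]
    rw [integral_finsetSum _ fun i _ => integrable_finsetSum _ fun j _ =>
      ((hi _).const_mul _).const_mul _]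
    simp only [dotProduct, Matrix.mulVec, star_trivial]
    refine Finset.sum_congr rfl fun i _ => ?_
    rw [integral_finsetSum _ fun j _ => ((hi _).const_mul _).const_mul _, Finset.mul_sum]
    refine Finset.sum_congr rfl fun j _ => ?_
    rw [integral_const_mul, integral_const_mul, Matrix.of_apply]
    ring
  rw [hval, setIntegral_pos_iff_support_of_nonneg_ae _ hint]
  · have hsub : Ioi (0:ℝ) \ (P.roots.toFinset : Set ℝ) ⊆
        Function.support (fun t => ω t * (P.eval t) ^ 2) ∩ Ioi 0 := by
      intro t ⟨ht, hr⟩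
      refine ⟨?_, ht⟩
      have : P.eval t ≠ 0 := by simpa [hPne] using hr
      exact mul_ne_zero (hω t ht).ne' (pow_ne_zero 2 this)
    refine lt_of_lt_of_le ?_ (measure_mono hsub)
    rw [measure_sdiff_null (P.roots.toFinset.finite_toSet.measure_zero _)]
    simp
  · refine (ae_restrict_mem measurableSet_Ioi).mono fun t ht => ?_
    exact mul_nonneg (hω t ht).le (sq_nonneg _)

theorem det_ascPochhammer_mul_tricomiIntegral_pos (a : ℝ) {b z : ℝ} (hz : 0 < z) (m : ℕ)
    (hb : (m : ℝ) < b) :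
    0 < (Matrix.of fun i j : Fin (m + 1) => (ascPochhammer ℝ (i : ℕ)).eval (a + (j : ℕ)) *
      tricomiIntegral b (a + (i : ℕ) + (j : ℕ)) z).det := by
  have hlt : ∀ i : Fin (m + 1), ((i : ℕ) : ℝ) < b := fun i =>
    lt_of_le_of_lt (Nat.cast_le.2 (Nat.lt_succ_iff.1 i.2)) hb
  choose τ h1 h2 h3 using fun i : Fin (m + 1) =>
    exists_ascPochhammer_mul_tricomiIntegral hz (i : ℕ) b (hlt i)
  set ω : ℝ → ℝ := fun t => Real.exp (-t * z) * t ^ (b - m - 1) * (1 + t) ^ (-(a + m)) with hω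
  have hωk : ∀ k : ℕ, ∀ t ∈ Ioi (0:ℝ), ω t * t ^ k =
      Real.exp (-t * z) * t ^ (b - m + k - 1) * (1 + t) ^ (-(a + m)) := by
    intro k t ht
    have ht : 0 < t := ht
    rw [show b - m + k - 1 = (b - m - 1) + k by ring, Real.rpow_add ht, Real.rpow_natCast]
    simp only [hω]; ring
  have hint : ∀ k : ℕ, IntegrableOn (fun t => ω t * t ^ k) (Ioi 0) := fun k => by
    rw [integrableOn_congr_fun (hωk k) measurableSet_Ioi]
    exact integrableOn_tricomi (by have : (0:ℝ) ≤ k := k.cast_nonneg; linarith) _ hz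
  have hgram := posDef_gram_monomials ω (fun t ht => by simp only [hω]; positivity) hint
    (fun i : Fin (m + 1) => m - (i : ℕ)) (fun i j hij => by
      have := i.2; have := j.2; ext; simp only at hij; omega)
  set Q : Matrix (Fin (m + 1)) (Fin (m + 1)) ℝ :=
    Matrix.of fun i j => ∫ t in Ioi (0:ℝ), ω t * t ^ ((m - (i : ℕ)) + (m - (j : ℕ))) with hQ
  set T : Matrix (Fin (m + 1)) (Fin (m + 1)) ℝ := Matrix.of fun i l => τ i l with hT
  set U : Matrix (Fin (m + 1)) (Fin (m + 1)) ℝ :=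
    Matrix.of fun l j => ((m - (j : ℕ)).choose (m - (l : ℕ)) : ℝ) with hU
  have hTdet : 0 < T.det := by
    rw [Matrix.det_of_isLowerTriangular T fun i j hij => h2 i j hij]
    exact Finset.prod_pos fun i _ => h1 i
  have hUdet : U.det = 1 := by
    rw [Matrix.det_of_isLowerTriangular U fun i j hij => ?_]
    · exact Finset.prod_eq_one fun i _ => by simp [hU]
    · have hij : i < j := hij
      have : m - (j : ℕ) < m - (i : ℕ) := by have := j.2; omega
      simp [hU, Nat.choose_eq_zero_of_lt this]
  have hbinom : ∀ (j : Fin (m + 1)) (t : ℝ),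
      ∑ l : Fin (m + 1), U l j * t ^ (m - (l : ℕ)) = (1 + t) ^ (m - (j : ℕ)) := by
    intro j t
    simp only [hU, Matrix.of_apply]
    rw [Fin.sum_univ_eq_sum_range
      (fun l => ((m - (j : ℕ)).choose (m - l) : ℝ) * t ^ (m - l)) (m + 1)]
    have := Finset.sum_range_reflect (fun l => ((m - (j : ℕ)).choose l : ℝ) * t ^ l) (m + 1)
    simp only [Nat.add_sub_cancel] at this
    rw [this, add_comm 1 t, add_pow]
    symm
    simp only [one_pow, mul_one]
    rw [Finset.sum_congr rfl fun x _ => mul_comm _ _]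
    refine Finset.sum_subset (Finset.range_subset_range.2 (by omega)) fun x _ hx => ?_
    rw [Nat.choose_eq_zero_of_lt (by simpa using hx)]
    simp
  have hG : ∀ l j : Fin (m + 1),
      tricomiIntegral (b - (l : ℕ)) (a + (j : ℕ)) z = (Q * U) l j := by
    intro l j
    rw [Matrix.mul_apply]
    simp only [hQ, Matrix.of_apply]
    simp_rw [← integral_mul_const]
    rw [← integral_finsetSum _ fun i _ => (hint _).mul_const _, tricomiIntegral]
    refine setIntegral_congr_fun measurableSet_Ioi fun t ht => ?_
    have ht : 0 < t := ht
    have hl : (((m - (l : ℕ) : ℕ)) : ℝ) = m - (l : ℕ) := Nat.cast_sub (Nat.lt_succ_iff.1 l.2)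
    have hj : (((m - (j : ℕ) : ℕ)) : ℝ) = m - (j : ℕ) := Nat.cast_sub (Nat.lt_succ_iff.1 j.2)
    have e1 : t ^ (b - (l : ℕ) - 1) = t ^ (b - m - 1) * t ^ (m - (l : ℕ)) := by
      rw [← Real.rpow_natCast, ← Real.rpow_add ht, hl]; ring_nf
    have e2 : (1 + t) ^ (-(a + (j : ℕ))) = (1 + t) ^ (-(a + m)) * (1 + t) ^ (m - (j : ℕ)) := by
      rw [← Real.rpow_natCast, ← Real.rpow_add (by positivity), hj]; ring_nf
    rw [e1, e2, ← hbinom j t, Finset.mul_sum, Finset.mul_sum]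
    refine Finset.sum_congr rfl fun i _ => ?_
    simp only [hω, pow_add]
    ring
  have hM : (Matrix.of fun i j : Fin (m + 1) => (ascPochhammer ℝ (i : ℕ)).eval (a + (j : ℕ)) *
      tricomiIntegral b (a + (i : ℕ) + (j : ℕ)) z) = T * (Q * U) := by
    ext i j
    rw [Matrix.mul_apply, Matrix.of_apply, add_right_comm, h3 i]
    simp only [← hG, hT, Matrix.of_apply]
    rw [Fin.sum_univ_eq_sum_range (fun l => τ i l * tricomiIntegral (b - l) (a + (j : ℕ)) z)]
    refine Finset.sum_subset (Finset.range_subset_range.2 (by have := i.2; omega))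
      fun x _ hx => ?_
    rw [h2 i x (by simp at hx; omega), zero_mul]
  rw [hM, Matrix.det_mul, Matrix.det_mul, hUdet, mul_one]
  exact mul_pos hTdet hgram.det_pos

/-- The regularised moments of `s ^ (a - 1) * exp (-s) * (s + z) ^ (-b)`, up to a factor `Γ(b)`. -/
noncomputable def tricomiMoment (a b z : ℝ) (l : ℕ) : ℝ :=
  Real.Gamma (a + l) * tricomiIntegral b (a + l) z

theorem posDef_hankelMatrix_tricomiMoment {a b z : ℝ} (ha : 0 < a) (hb : 0 < b) (hz : 0 < z)
    (N : ℕ) : (hankelMatrix (tricomiMoment a b z) N).PosDef := by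
  have hmom : ∀ t : ℝ, 0 < t → ∀ k : ℕ,
      ∫ s in Ioi (0:ℝ), (s ^ (a - 1) * Real.exp (-((1 + t) * s))) * s ^ k =
        Real.Gamma (a + k) * (1 + t) ^ (-(a + k)) := by
    intro t ht k
    have hk : (0:ℝ) ≤ k := k.cast_nonneg
    have h := Real.integral_rpow_mul_exp_neg_mul_Ioi (a := a + k) (r := 1 + t)
      (by linarith) (by linarith)
    rw [one_div, Real.inv_rpow (by positivity), ← Real.rpow_neg (by positivity), mul_comm] at h
    rw [← h]
    refine setIntegral_congr_fun measurableSet_Ioi fun s hs => ?_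
    have hs : 0 < s := hs
    rw [show a + k - 1 = (a - 1) + k by ring, Real.rpow_add hs, Real.rpow_natCast]
    ring
  have hpd : ∀ t : ℝ, 0 < t → (Matrix.of fun i j : Fin N =>
      Real.Gamma (a + (i + j : ℕ)) * (1 + t) ^ (-(a + (i + j : ℕ)))).PosDef := by
    intro t ht
    simp only [← hmom t ht]
    refine posDef_gram_monomials (fun s => s ^ (a - 1) * Real.exp (-((1 + t) * s)))
      (fun s hs => by positivity) (fun k => ?_) _ Fin.val_injective
    have hk : (0:ℝ) ≤ k := k.cast_nonneg
    have hi := integrableOn_rpow_mul_exp_neg_mul_rpow (s := a - 1 + k) (p := 1) (b := 1 + t)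
      (by linarith) one_pos (by linarith)
    refine hi.congr_fun (fun s hs => ?_) measurableSet_Ioi
    have hs : 0 < s := hs
    simp only
    rw [Real.rpow_add hs, Real.rpow_natCast, Real.rpow_one]
    ring_nf
  refine Matrix.PosDef.of_dotProduct_mulVec_pos ?_ fun x hx => ?_
  · ext i j; simp [hankelMatrix, add_comm]
  set q : ℝ → ℝ := fun t => ∑ i : Fin N, ∑ j : Fin N, x i * (x j * (Real.Gamma (a + (i + j : ℕ)) *
    (Real.exp (-t * z) * t ^ (b - 1) * (1 + t) ^ (-(a + (i + j : ℕ)))))) with hq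
  have hqpos : ∀ t ∈ Ioi (0:ℝ), 0 < q t := by
    intro t ht
    have ht : 0 < t := ht
    have h := (hpd t ht).dotProduct_mulVec_pos hx
    have h2 : q t = Real.exp (-t * z) * t ^ (b - 1) * (star x ⬝ᵥ (Matrix.of fun i j : Fin N =>
        Real.Gamma (a + (i + j : ℕ)) * (1 + t) ^ (-(a + (i + j : ℕ)))).mulVec x) := by
      simp only [hq, dotProduct, Matrix.mulVec, star_trivial, Finset.mul_sum, Matrix.of_apply]
      refine Finset.sum_congr rfl fun i _ => Finset.sum_congr rfl fun j _ => ?_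
      ring
    rw [h2]
    positivity
  have hint : ∀ i j : Fin N, IntegrableOn (fun t => x i * (x j * (Real.Gamma (a + (i + j : ℕ)) *
    (Real.exp (-t * z) * t ^ (b - 1) * (1 + t) ^ (-(a + (i + j : ℕ))))))) (Ioi 0) :=
    fun i j => (((integrableOn_tricomi hb _ hz).const_mul _).const_mul _).const_mul _
  have hval : star x ⬝ᵥ (hankelMatrix (tricomiMoment a b z) N).mulVec x =
      ∫ t in Ioi (0:ℝ), q t := by
    simp only [hq]
    rw [integral_finsetSum _ fun i _ => integrable_finsetSum _ fun j _ => hint i j]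
    simp only [dotProduct, Matrix.mulVec, star_trivial]
    refine Finset.sum_congr rfl fun i _ => ?_
    rw [integral_finsetSum _ fun j _ => hint i j, Finset.mul_sum]
    refine Finset.sum_congr rfl fun j _ => ?_
    rw [integral_const_mul, integral_const_mul, integral_const_mul, hankelMatrix, Matrix.of_apply,
      tricomiMoment, tricomiIntegral]
    ring
  rw [hval, setIntegral_pos_iff_support_of_nonneg_ae]
  · have : Function.support q ∩ Ioi 0 = Ioi 0 :=
      inter_eq_right.2 fun t ht => (hqpos t ht).ne'
    rw [this]; simp
  · exact (ae_restrict_mem measurableSet_Ioi).mono fun t ht => (hqpos t ht).le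
  · exact integrable_finsetSum _ fun i _ => integrable_finsetSum _ fun j _ => hint i j

theorem Gamma_add_natCast (x : ℝ) (n : ℕ) (hx : ∀ k : ℕ, x ≠ -k) :
    Real.Gamma (x + n) = (ascPochhammer ℝ n).eval x * Real.Gamma x := by
  induction n with
  | zero => simp
  | succ n ih =>
    have : x + n ≠ 0 := fun h => hx n (by linarith)
    push_cast
    rw [← add_assoc, Real.Gamma_add_one this, ih, ascPochhammer_succ_eval]
    ring

theorem Gamma_neg_of_mem_Ioo (q : ℕ) : ∀ x : ℝ, -(2 * q + 1 : ℝ) < x → x < -(2 * q : ℝ) →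
    Real.Gamma x < 0 := by
  induction q with
  | zero =>
    intro x h1 h2
    norm_num at h1 h2
    have h := Real.Gamma_add_one h2.ne
    have hp : 0 < Real.Gamma (x + 1) := Real.Gamma_pos_of_pos (by linarith)
    rw [h] at hp
    exact neg_of_mul_pos_right hp h2.le
  | succ q ih =>
    intro x h1 h2
    push_cast at h1 h2
    have hq : (0:ℝ) ≤ q := q.cast_nonneg
    have hn := ih (x + 1 + 1) (by linarith) (by linarith)
    rw [Real.Gamma_add_one (by linarith), Real.Gamma_add_one (by linarith), ← mul_assoc] at hn
    exact neg_of_mul_neg_right hn (mul_nonneg_of_nonpos_of_nonpos (by linarith) (by linarith))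

theorem det_hankelMatrix_tricomiMoment {a b z : ℝ} (ha : ∀ k : ℕ, a ≠ -k) (N : ℕ) :
    (hankelMatrix (tricomiMoment a b z) N).det = (∏ j : Fin N, Real.Gamma (a + (j : ℕ))) *
      (Matrix.of fun i j : Fin N => (ascPochhammer ℝ (i : ℕ)).eval (a + (j : ℕ)) *
        tricomiIntegral b (a + (i : ℕ) + (j : ℕ)) z).det := by
  rw [← Matrix.det_mul_row]
  congr 1
  ext i j
  have h : ∀ k : ℕ, a + (j : ℕ) ≠ -k := fun k hk => ha (j + k) (by push_cast; linarith)
  simp only [hankelMatrix, tricomiMoment, Matrix.of_apply]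
  push_cast
  rw [show a + ((i : ℕ) + (j : ℕ) : ℝ) = a + (j : ℕ) + (i : ℕ) by ring,
    Gamma_add_natCast _ _ h, show a + (i : ℕ) + (j : ℕ) = a + (j : ℕ) + (i : ℕ) by ring]
  ring

/-- Positivity when `a` lies in `(-(m + 1), -m)`, `b > m`, and the size exceeds `m`. -/
theorem det_ascPochhammer_mul_tricomiIntegral_pos_of_lt {a b z : ℝ} (hz : 0 < z) (m N : ℕ)
    (hN : m < N) (h1 : -(m + 1 : ℝ) < a) (h2 : a < -(m : ℝ)) (hb : (m : ℝ) < b) :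
    0 < (Matrix.of fun i j : Fin N => (ascPochhammer ℝ (i : ℕ)).eval (a + (j : ℕ)) *
      tricomiIntegral b (a + (i : ℕ) + (j : ℕ)) z).det := by
  have hm0 : (0:ℝ) ≤ m := m.cast_nonneg
  have ha : ∀ k : ℕ, a ≠ -k := by
    intro k hk
    have h3 : m < k := by exact_mod_cast (show (m : ℝ) < k by linarith)
    have h4 : k < m + 1 := by exact_mod_cast (show (k : ℝ) < m + 1 by linarith)
    omega
  have hminor : ∀ j ≤ m, 0 < (Matrix.of fun i j : Fin (j + 1) =>
      (ascPochhammer ℝ (i : ℕ)).eval (a + (j : ℕ)) *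
        tricomiIntegral b (a + (i : ℕ) + (j : ℕ)) z).det := fun j hj =>
    det_ascPochhammer_mul_tricomiIntegral_pos a hz j
      (lt_of_le_of_lt (Nat.cast_le.2 hj) hb)
  have hminor' : ∀ j ≤ m, 0 < (Matrix.of fun i j : Fin j =>
      (ascPochhammer ℝ (i : ℕ)).eval (a + (j : ℕ)) *
        tricomiIntegral b (a + (i : ℕ) + (j : ℕ)) z).det := by
    rintro (_ | j) hj
    · simp
    · exact hminor j (by omega)
  have hΓne : ∀ j : ℕ, Real.Gamma (a + j) ≠ 0 := fun j =>
    Real.Gamma_ne_zero fun k hk => ha (j + k) (by push_cast; linarith)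
  have hsign : ∀ M, m < M →
      0 < (-1 : ℝ) ^ (m / 2 + 1) * (hankelMatrix (tricomiMoment a b z) M).det := by
    intro M hM
    obtain ⟨s, rfl⟩ : ∃ s, M = (m / 2 + 1) + s := ⟨M - (m / 2 + 1), by omega⟩
    refine hankelMatrix_det_sign _ _ s (fun q => m - 2 * (q : ℕ)) ?_ ?_ ?_ ?_
    · intro q q' h
      have := q.2; have := q'.2
      ext; simp only at h; omega
    · intro q; omega
    · intro q
      have hq := q.2
      have hj : m - 2 * (q : ℕ) ≤ m := Nat.sub_le _ _
      have hcast : ((m - 2 * (q : ℕ) : ℕ) : ℝ) = m - 2 * (q : ℕ) := by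
        rw [Nat.cast_sub (by omega)]; push_cast; ring
      have hΓ : Real.Gamma (a + (m - 2 * (q : ℕ) : ℕ)) < 0 :=
        Gamma_neg_of_mem_Ioo q _ (by rw [hcast]; linarith) (by rw [hcast]; linarith)
      have hsq : 0 < (∏ j : Fin (m - 2 * (q : ℕ)), Real.Gamma (a + (j : ℕ))) ^ 2 :=
        sq_pos_of_ne_zero (Finset.prod_ne_zero_iff.2 fun j _ => hΓne j)
      rw [det_hankelMatrix_tricomiMoment ha, det_hankelMatrix_tricomiMoment ha,
        Fin.prod_univ_castSucc]
      simp only [Fin.val_castSucc, Fin.val_last]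
      have hpos := mul_pos hsq (mul_pos (hminor _ hj) (hminor' _ hj))
      have := mul_neg_of_neg_of_pos hΓ hpos
      refine lt_of_eq_of_lt ?_ this
      ring
    · have hpd := posDef_hankelMatrix_tricomiMoment (a := a + (2 * (m / 2 + 1) : ℕ)) (b := b)
        (by
          have : (m + 1 : ℝ) ≤ (2 * (m / 2 + 1) : ℕ) := by exact_mod_cast (by omega)
          linarith) (by linarith) hz s
      convert hpd using 2
      ext l
      simp only [tricomiMoment]
      push_cast
      ring_nf
  have hm := hsign (m + 1) (Nat.lt_succ_self m)
  have hn := hsign N hN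
  rw [det_hankelMatrix_tricomiMoment ha] at hm hn
  have hm' := hminor m le_rfl
  rw [← mul_assoc] at hm hn
  have hprodm := pos_of_mul_pos_left hm hm'.le
  refine pos_of_mul_pos_right hn (le_of_lt ?_)
  obtain ⟨p, rfl⟩ : ∃ p, N = (m + 1) + p := ⟨N - (m + 1), by omega⟩
  rw [Fin.prod_univ_add, ← mul_assoc]
  refine mul_pos hprodm (Finset.prod_pos fun i _ => Real.Gamma_pos_of_pos ?_)
  have : (0:ℝ) ≤ (i : ℕ) := Nat.cast_nonneg _
  simp only [Fin.val_natAdd]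
  push_cast
  linarith

/-- If `(d,b)` belongs to the upper staircase region `E_n^+`, i.e. there is
`k ∈ {1,…,n}` with `k-1 < d < k` and `n-k < b < n-k+1`, then `D^n_{b,d}(z) > 0`
for every `z > 0`. -/
theorem hankelD_pos_upper_staircase (n : ℕ) (hn : 1 ≤ n) (b d : ℝ)
    (h : ∃ k : ℕ, 1 ≤ k ∧ k ≤ n ∧ (k : ℝ) - 1 < d ∧ d < (k : ℝ) ∧
      (n : ℝ) - (k : ℝ) < b ∧ b < (n : ℝ) - (k : ℝ) + 1)
    (z : ℝ) (hz : 0 < z) :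
    0 < hankelD n b d z := by
  obtain ⟨k, hk1, hkn, hd1, hd2, hb1, -⟩ := h
  have hcast : ((n - k : ℕ) : ℝ) = n - k := Nat.cast_sub hkn
  have hb : 0 < b := by
    have : (0:ℝ) ≤ (n - k : ℕ) := Nat.cast_nonneg _
    linarith
  have hpos := det_ascPochhammer_mul_tricomiIntegral_pos_of_lt (a := d - n) (b := b) hz (n - k)
    (n + 1) (by omega) (by rw [hcast]; linarith) (by rw [hcast]; linarith) (by rw [hcast]; linarith)
  have hscale : hankelD n b d z = (∏ _j : Fin (n + 1), 1 / Real.Gamma b) *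
      (Matrix.of fun i j : Fin (n + 1) => (ascPochhammer ℝ (i : ℕ)).eval (d - n + (j : ℕ)) *
        tricomiIntegral b (d - n + (i : ℕ) + (j : ℕ)) z).det := by
    rw [← Matrix.det_mul_row, hankelD]
    congr 1
    ext i j
    simp only [Matrix.of_apply, tricomiF, tricomiIntegral]
    ring
  rw [hscale]
  exact mul_pos (Finset.prod_pos fun _ _ => one_div_pos.2 (Real.Gamma_pos_of_pos hb)) hpos
end

section
/- Let a > 1 and c < 1 + a. Then for every x > 0, Ψ(a, c, x)² ≤ Ψ(a−1, c−1, x)·Ψ(a+1, c+1, x). -/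
/-- The Tricomi confluent hypergeometric function of the second kind,
`Ψ(a, c, x) = (1/Γ(a)) ∫₀^∞ e^{-tx} t^{a-1} (1+t)^{c-a-1} dt`. -/
noncomputable def Psi (a c x : ℝ) : ℝ :=
  (1 / Real.Gamma a) * ∫ t in Set.Ioi (0:ℝ),
    Real.exp (-t * x) * t ^ (a - 1) * (1 + t) ^ (c - a - 1)

open MeasureTheory Set Real in
lemma integrableOn_rpow_mul_exp_neg {s : ℝ} (hs : 0 < s) {r : ℝ} (hr : 0 < r) :
    IntegrableOn (fun u : ℝ => u ^ (s - 1) * exp (-(r * u))) (Ioi 0) := by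
  simpa using integrableOn_rpow_mul_exp_neg_mul_rpow (p := 1) (s := s - 1) (b := r)
    (by linarith) one_pos hr

open MeasureTheory Set Real in
lemma integrableOn_rpow_mul_exp_neg_mul_add_rpow {s x a : ℝ} (hs : 0 < s) (hx : 0 < x)
    (ha : 0 ≤ a) :
    IntegrableOn (fun u : ℝ => u ^ (s - 1) * exp (-u) * (x + u) ^ (-a)) (Ioi 0) := by
  have h := (integrableOn_rpow_mul_exp_neg hs one_pos).mul_const (x ^ (-a))
  refine h.mono' (by fun_prop) ?_
  filter_upwards [ae_restrict_mem measurableSet_Ioi] with u hu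
  have hu : 0 < u := hu
  rw [norm_of_nonneg (by positivity), one_mul]
  gcongr ?_ * ?_
  exact rpow_le_rpow_of_nonpos hx (by linarith) (by linarith)

open MeasureTheory Set Real in
/-- The Tricomi function as a mixture of the powers `(x + u) ^ (-a)`. -/
lemma Psi_eq_integral_add_rpow {a c x : ℝ} (ha : 0 < a) (hc : c < 1 + a) (hx : 0 < x) :
    Psi a c x = 1 / Gamma (a + 1 - c) *
      ∫ u in Ioi (0 : ℝ), u ^ (a + 1 - c - 1) * exp (-u) * (x + u) ^ (-a) := by
  obtain ⟨s, hs⟩ : ∃ s, s = a + 1 - c := ⟨_, rfl⟩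
  have hs0 : 0 < s := by linarith
  have hΓa := (Gamma_pos_of_pos ha).ne'
  have hΓs := (Gamma_pos_of_pos hs0).ne'
  rw [Psi, ← hs, show c - a - 1 = -s by linarith]
  let F : ℝ → ℝ → ℝ := fun t u =>
    t ^ (a - 1) * exp (-(x * t)) * (u ^ (s - 1) * exp (-((1 + t) * u)))
  have hF : Integrable (Function.uncurry F)
      ((volume.restrict (Ioi 0)).prod (volume.restrict (Ioi 0))) := by
    refine ((integrableOn_rpow_mul_exp_neg ha hx).mul_prod
      (integrableOn_rpow_mul_exp_neg hs0 one_pos)).mono' ?_ ?_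
    · apply Measurable.aestronglyMeasurable
      simp only [F, Function.uncurry_def]
      fun_prop
    · rw [Measure.prod_restrict]
      filter_upwards [ae_restrict_mem (measurableSet_Ioi.prod measurableSet_Ioi)] with p hp
      have h1 : 0 < p.1 := hp.1
      have h2 : 0 < p.2 := hp.2
      simp only [F, Function.uncurry_def]
      rw [norm_of_nonneg (by positivity)]
      gcongr
      linarith
  have hinner (t : ℝ) (ht : t ∈ Ioi (0 : ℝ)) :
      ∫ u in Ioi (0 : ℝ), F t u =
        Gamma s * (exp (-t * x) * t ^ (a - 1) * (1 + t) ^ (-s)) := by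
    have ht : 0 < t := ht
    simp only [F]
    rw [integral_const_mul, integral_rpow_mul_exp_neg_mul_Ioi hs0 (by positivity), one_div,
      inv_rpow (by positivity), ← rpow_neg (by positivity), show -(x * t) = -t * x by ring]
    ring
  have houter (u : ℝ) (hu : u ∈ Ioi (0 : ℝ)) :
      ∫ t in Ioi (0 : ℝ), F t u =
        Gamma a * (u ^ (s - 1) * exp (-u) * (x + u) ^ (-a)) := by
    have hu : 0 < u := hu
    have hfun : (fun t => F t u) = fun t =>
        u ^ (s - 1) * exp (-u) * (t ^ (a - 1) * exp (-((x + u) * t))) := by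
      funext t
      simp only [F]
      rw [show -((x + u) * t) = -(x * t) + -(u * t) by ring,
        show -((1 + t) * u) = -u + -(u * t) by ring, exp_add, exp_add]
      ring
    rw [hfun, integral_const_mul, integral_rpow_mul_exp_neg_mul_Ioi ha (by positivity), one_div,
      inv_rpow (by positivity), ← rpow_neg (by positivity)]
    ring
  have h := integral_integral_swap hF
  rw [setIntegral_congr_fun measurableSet_Ioi hinner,
    setIntegral_congr_fun measurableSet_Ioi houter, integral_const_mul, integral_const_mul] at h
  rw [one_div, one_div, inv_mul_eq_div, inv_mul_eq_div, div_eq_div_iff hΓa hΓs]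
  linarith

open MeasureTheory Set Real in
lemma sq_integral_add_rpow_le {s x a : ℝ} (hs : 0 < s) (hx : 0 < x) (ha : 1 ≤ a) :
    (∫ u in Ioi (0 : ℝ), u ^ (s - 1) * exp (-u) * (x + u) ^ (-a)) ^ 2 ≤
      (∫ u in Ioi (0 : ℝ), u ^ (s - 1) * exp (-u) * (x + u) ^ (-(a - 1))) *
        ∫ u in Ioi (0 : ℝ), u ^ (s - 1) * exp (-u) * (x + u) ^ (-(a + 1)) := by
  have i0 := integrableOn_rpow_mul_exp_neg_mul_add_rpow hs hx (a := a - 1) (by linarith)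
  have i1 := integrableOn_rpow_mul_exp_neg_mul_add_rpow hs hx (a := a) (by linarith)
  have i2 := integrableOn_rpow_mul_exp_neg_mul_add_rpow hs hx (a := a + 1) (by linarith)
  set A := ∫ u in Ioi (0 : ℝ), u ^ (s - 1) * exp (-u) * (x + u) ^ (-(a - 1))
  set B := ∫ u in Ioi (0 : ℝ), u ^ (s - 1) * exp (-u) * (x + u) ^ (-a)
  set C := ∫ u in Ioi (0 : ℝ), u ^ (s - 1) * exp (-u) * (x + u) ^ (-(a + 1))
  have key (l : ℝ) : 0 ≤ A * (l * l) + (-2 * B) * l + C := by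
    have h : A * (l * l) + (-2 * B) * l + C = ∫ u in Ioi (0 : ℝ),
        (u ^ (s - 1) * exp (-u) * (x + u) ^ (-(a - 1)) * (l * l) +
          u ^ (s - 1) * exp (-u) * (x + u) ^ (-a) * (-2 * l) +
          u ^ (s - 1) * exp (-u) * (x + u) ^ (-(a + 1))) := by
      rw [integral_add (by exact (i0.mul_const _).add (i1.mul_const _)) i2,
        integral_add (i0.mul_const _) (i1.mul_const _), integral_mul_const, integral_mul_const]
      ring
    rw [h]
    refine setIntegral_nonneg measurableSet_Ioi fun u hu => ?_
    have hu : 0 < u := hu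
    have hxu : 0 < x + u := by positivity
    rw [show -(a - 1) = -(a + 1) + 1 + 1 by ring, show -a = -(a + 1) + 1 by ring,
      rpow_add_one hxu.ne', rpow_add_one hxu.ne']
    have : 0 ≤ u ^ (s - 1) * exp (-u) * (x + u) ^ (-(a + 1)) * ((x + u) * l - 1) ^ 2 := by
      positivity
    linarith
  have := discrim_le_zero key
  rw [discrim] at this
  linarith

/-- Turán-type inequality: for `a > 1` and `c < 1 + a`,
`Ψ(a,c)² ≤ Ψ(a-1,c-1) Ψ(a+1,c+1)` on `(0,∞)`. -/
theorem psi_turan_inequality_basic (a c : ℝ) (ha : 1 < a) (hc : c < 1 + a)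
    (x : ℝ) (hx : 0 < x) :
    (Psi a c x) ^ 2 ≤ Psi (a - 1) (c - 1) x * Psi (a + 1) (c + 1) x := by
  rw [Psi_eq_integral_add_rpow (by linarith) hc hx,
    Psi_eq_integral_add_rpow (a := a - 1) (by linarith) (by linarith) hx,
    Psi_eq_integral_add_rpow (a := a + 1) (by linarith) (by linarith) hx,
    show a - 1 + 1 - (c - 1) = a + 1 - c by ring, show a + 1 + 1 - (c + 1) = a + 1 - c by ring,
    mul_pow, mul_mul_mul_comm, ← sq]
  gcongr
  exact sq_integral_add_rpow_le (by linarith) hx ha.le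
end
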